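/- Let r ≥ 0 and s ≥ 1 be integers and g = r + s − 1. For every monic polynomial f ∈ A⁺ of degree d ≤ g which is not a perfect square, Σ_{u ∈ I_{(r,s)}} {u/f} ≤ 2^{d/2 − s}·q^{r+s}. Consequently, there is a constant C > 0 depending only on q such that for every g ≥ 1 and every monic f of degree d ≤ g which is not a perfect square, |Σ_{u ∈ I_{g+1}} {u/f}| ≤ C·g·2^{d/2}·q^{g}. -/

import Mathlib

open Polynomial UniqueFactorizationMonoid

noncomputable section

namespace EvenChar

variable {Fq : Type} [Field Fq] [Fintype Fq]

/-- Solvability of the congruence `X² + X ≡ u (mod P)` in `Fq[T]`. -/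
def hasseSolvable (u : RatFunc Fq) (P : Polynomial Fq) : Prop :=
  ∃ x : Polynomial Fq, P ∣ ((x ^ 2 + x) * u.denom - u.num)

open scoped Classical in
/-- The quadratic symbol `{u/f}` for a monic polynomial `f`. -/
def quadSym (u : RatFunc Fq) (f : Polynomial Fq) : ℤ :=
  if IsCoprime f u.denom then
    ((normalizedFactors f).map fun P => if hasseSolvable u P then (1 : ℤ) else -1).prod
  else 0

variable (Fq) in
/-- The family `F_n` of real quadratic `u`'s. -/
def Ffam (n : ℕ) : Set (RatFunc Fq) :=
  { u | ∃ (S : Finset (Polynomial Fq)) (e : Polynomial Fq → ℕ)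
        (a : Polynomial Fq → ℕ → Polynomial Fq),
      (∀ P ∈ S, P.Monic ∧ Irreducible P) ∧
      (∀ P ∈ S, 1 ≤ e P) ∧
      (∀ P ∈ S, ∀ i, 1 ≤ i → i ≤ e P → (a P i).degree < P.degree) ∧
      (∀ P ∈ S, a P (e P) ≠ 0) ∧
      (∑ P ∈ S, e P * P.natDegree) = n ∧
      u = ∑ P ∈ S, ∑ i ∈ Finset.Icc 1 (e P),
            algebraMap (Polynomial Fq) (RatFunc Fq) (a P i) /
              algebraMap (Polynomial Fq) (RatFunc Fq) P ^ (2 * i - 1) }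

/-- The family `G_s` of odd polynomial parts. -/
def Gfam (ξ : Fq) (s : ℕ) : Set (Polynomial Fq) :=
  { G | ∃ (α : Fq) (c : ℕ → Fq), (α = 0 ∨ α = ξ) ∧ c s ≠ 0 ∧
      G = C α + ∑ i ∈ Finset.Icc 1 s, C (c i) * X ^ (2 * i - 1) }

/-- The family `I_{(r,s)}`. -/
def Irs (ξ : Fq) (r s : ℕ) : Set (RatFunc Fq) :=
  { u | ∃ v ∈ Ffam Fq r, ∃ G ∈ Gfam ξ s,
      u = v + algebraMap (Polynomial Fq) (RatFunc Fq) G }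

/-- The family `I_n` of ramified imaginary `u`'s. -/
def Ifam (ξ : Fq) (n : ℕ) : Set (RatFunc Fq) :=
  ⋃ (r : ℕ) (s : ℕ) (_ : 1 ≤ s) (_ : r + s = n), Irs ξ r s

/-- The family `F'_n` of inert imaginary `u`'s. -/
def F'fam (ξ : Fq) (n : ℕ) : Set (RatFunc Fq) :=
  (fun u => u + RatFunc.C ξ) '' Ffam Fq n

/-- `A_u(n) = ∑_{f monic, deg f = n} χ_u(f)`. -/
def Acoeff (u : RatFunc Fq) (n : ℕ) : ℂ :=
  ∑' f : {f : Polynomial Fq // f.Monic ∧ f.natDegree = n}, (quadSym u f.1 : ℂ)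

/-- `L(s, χ_u)` as the polynomial `∑_{n=0}^{N} A_u(n) q^{-sn}` in `q^{-s}`. -/
def Lfun (N : ℕ) (u : RatFunc Fq) (s : ℂ) : ℂ :=
  ∑ n ∈ Finset.range (N + 1), Acoeff u n * (Fintype.card Fq : ℂ) ^ (-(s * (n : ℂ)))

/-- `ζ_A(s) = (1 - q^{1-s})⁻¹`. -/
def zetaC (q : ℕ) (s : ℂ) : ℂ := (1 - (q : ℂ) ^ ((1 : ℂ) - s))⁻¹

variable (Fq) in
/-- The Euler product `P(s) = ∏_P (1 - 1/(|P|^s (|P|+1)))`. -/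
def eulerP (s : ℂ) : ℂ :=
  ∏' P : {P : Polynomial Fq // P.Monic ∧ Irreducible P},
    (1 - (((Fintype.card Fq : ℂ) ^ (P.1.natDegree : ℂ)) ^ s *
          ((Fintype.card Fq : ℂ) ^ (P.1.natDegree : ℂ) + 1))⁻¹)

variable (Fq) in
/-- `(1/log q)·(P'/P)(1) = ∑_P deg P / (|P|(|P|+1) - 1)`. -/
def eulerPlogDeriv : ℂ :=
  ∑' P : {P : Polynomial Fq // P.Monic ∧ Irreducible P},
    (P.1.natDegree : ℂ) /
      ((Fintype.card Fq : ℂ) ^ (P.1.natDegree : ℂ) *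
        ((Fintype.card Fq : ℂ) ^ (P.1.natDegree : ℂ) + 1) - 1)

end EvenChar

namespace EvenChar

/-- Artin-Schreier solvability in a finite field of characteristic two is vanishing of the trace. -/
theorem as_iff_trace (K : Type) [Field K] [Finite K] [Algebra (ZMod 2) K] (t : K) :
    (∃ x : K, x ^ 2 + x = t) ↔ Algebra.trace (ZMod 2) K t = 0 := by
  haveI : Fintype K := Fintype.ofFinite K
  haveI : CharP K 2 := charP_of_injective_algebraMap (algebraMap (ZMod 2) K).injective 2
  haveI : Fact (Nat.Prime 2) := ⟨Nat.prime_two⟩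
  let φ : K →+ K :=
    { toFun := fun x => x ^ 2 + x
      map_zero' := by simp
      map_add' := fun x y => by
        change (x + y) ^ 2 + (x + y) = _
        rw [add_pow_char]; ring }
  let τ : K →+ ZMod 2 := (Algebra.trace (ZMod 2) K).toAddMonoidHom
  have hτ : Function.Surjective τ := Algebra.trace_surjective (ZMod 2) K
  have hle : φ.range ≤ τ.ker := by
    rintro _ ⟨x, rfl⟩
    change Algebra.trace (ZMod 2) K (x ^ 2 + x) = 0
    have h1 : Algebra.trace (ZMod 2) K (x ^ 2) = Algebra.trace (ZMod 2) K x := by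
      have := Algebra.trace_eq_of_algEquiv (FiniteField.frobeniusAlgEquiv (ZMod 2) K 2) x
      simpa [FiniteField.frobeniusAlgEquiv_apply, ZMod.card] using this
    rw [map_add, h1]
    exact CharTwo.add_self_eq_zero _
  have hker : Nat.card φ.ker ≤ 2 := by
    have : (φ.ker : Set K) ⊆ ({0, 1} : Set K) := by
      intro x hx
      have hx' : x ^ 2 + x = 0 := hx
      have : x * (x + 1) = 0 := by rw [← hx']; ring
      rcases mul_eq_zero.mp this with h | h
      · left; exact h
      · right
        have := eq_neg_of_add_eq_zero_left h
        simpa [CharTwo.neg_eq] using this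
    calc Nat.card φ.ker = Set.ncard (φ.ker : Set K) := rfl
      _ ≤ Set.ncard ({0, 1} : Set K) := Set.ncard_le_ncard this
      _ ≤ 2 := Set.ncard_insert_le _ _ |>.trans (by simp)
  have c1 : Nat.card K = Nat.card φ.range * Nat.card φ.ker := by
    rw [← AddSubgroup.card_mul_index φ.ker, AddSubgroup.index_ker, mul_comm]
  have c2 : Nat.card K = 2 * Nat.card τ.ker := by
    rw [← AddSubgroup.card_mul_index τ.ker, AddSubgroup.index_ker, mul_comm,
      AddMonoidHom.range_eq_top.mpr hτ]
    simp
  have heq : φ.range = τ.ker := by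
    apply AddSubgroup.eq_of_le_of_card_ge hle
    nlinarith [Nat.card_pos (α := φ.range)]
  have : t ∈ φ.range ↔ t ∈ τ.ker := by rw [heq]
  exact this

variable {Fq : Type} [Field Fq] [Fintype Fq]

open scoped Classical in
/-- The basic additive character of `Fq`. -/
def psi (t : Fq) : ℤ := if ∃ x : Fq, x ^ 2 + x = t then 1 else -1

theorem psi_add [CharP Fq 2] (s t : Fq) : psi (s + t) = psi s * psi t := by
  letI : Algebra (ZMod 2) Fq := ZMod.algebra Fq 2
  unfold psi
  simp only [as_iff_trace, map_add]
  have h2 : ∀ a b : ZMod 2, (if a + b = 0 then (1 : ℤ) else -1) =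
    (if a = 0 then 1 else -1) * (if b = 0 then 1 else -1) := by decide
  convert h2 _ _

theorem psi_zero : psi (0 : Fq) = 1 := by
  unfold psi
  rw [if_pos ⟨0, by simp⟩]

/-- An algebraic closure used for evaluations. -/
abbrev Lc (Fq : Type) [Field Fq] : Type := AlgebraicClosure Fq

/-- evaluation of a rational function at a point of the closure. -/
def ev (θ : Lc Fq) (u : RatFunc Fq) : Lc Fq := RatFunc.eval (algebraMap Fq (Lc Fq)) θ u

/-- sum of the values of `u` at the roots of `f`. -/
def Lam (f : Polynomial Fq) (u : RatFunc Fq) : Lc Fq :=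
  ((f.aroots (Lc Fq)).map fun θ => ev θ u).sum

theorem denom_ne_of_coprime {f : Polynomial Fq} {u : RatFunc Fq} (h : IsCoprime f u.denom)
    {θ : Lc Fq} (hθ : θ ∈ f.aroots (Lc Fq)) :
    Polynomial.eval₂ (algebraMap Fq (Lc Fq)) θ u.denom ≠ 0 := by
  intro h0
  obtain ⟨a, b, hab⟩ := h
  have h1 := (mem_aroots'.mp hθ).2
  have := congrArg (aeval θ) hab
  rw [map_add, map_mul, map_mul, h1, aeval_def θ u.denom, h0] at this
  simp at this

theorem sgn_prime [CharP Fq 2] {P : Polynomial Fq} (hP : Irreducible P) {u : RatFunc Fq}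
    (h : IsCoprime P u.denom) :
    ∃ t : Fq, algebraMap Fq (Lc Fq) t = Lam P u ∧ (hasseSolvable u P ↔ ∃ x : Fq, x ^ 2 + x = t) := by
  letI : Algebra (ZMod 2) Fq := ZMod.algebra Fq 2
  haveI : Fact (Irreducible P) := ⟨hP⟩
  haveI : Module.Finite Fq (AdjoinRoot P) := (AdjoinRoot.powerBasis hP.ne_zero).finite
  haveI : Finite (AdjoinRoot P) := Module.finite_of_finite Fq
  have hd : AdjoinRoot.mk P u.denom ≠ 0 := by
    intro h0
    rw [AdjoinRoot.mk_eq_zero] at h0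
    exact hP.not_isUnit (h.isUnit_of_dvd' dvd_rfl h0)
  let ub : AdjoinRoot P := AdjoinRoot.mk P u.num / AdjoinRoot.mk P u.denom
  refine ⟨Algebra.trace Fq (AdjoinRoot P) ub, ?_, ?_⟩
  · rw [trace_eq_sum_embeddings (Lc Fq)]
    have hnd : (P.aroots (Lc Fq)).Nodup := by
      apply nodup_aroots_iff_of_splits hP.ne_zero (IsAlgClosed.splits _) |>.mpr
      exact PerfectField.separable_of_irreducible hP
    unfold Lam
    classical
    letI : Fintype {x // x ∈ P.aroots (Lc Fq)} :=
      Fintype.subtype (P.aroots (Lc Fq)).toFinset (by simp)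
    have e2 : ((P.aroots (Lc Fq)).map fun θ => ev θ u).sum
        = ∑ θ : {x // x ∈ P.aroots (Lc Fq)}, ev θ.1 u := by
      rw [← Finset.sum_subtype (P.aroots (Lc Fq)).toFinset (fun x => Multiset.mem_toFinset)
        (fun θ => ev θ u), Finset.sum, Multiset.toFinset_val, hnd.dedup]
    rw [e2]
    apply Fintype.sum_equiv (AdjoinRoot.equiv (Lc Fq) Fq P hP.ne_zero)
    intro σ
    have : ((AdjoinRoot.equiv (Lc Fq) Fq P hP.ne_zero) σ).1 = σ (AdjoinRoot.root P) := by
      rfl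
    rw [this]
    simp only [ev, RatFunc.eval, ub, map_div₀]
    have h3 : ∀ p : Polynomial Fq, σ (AdjoinRoot.mk P p) =
        eval₂ (algebraMap Fq (Lc Fq)) (σ (AdjoinRoot.root P)) p := by
      intro p
      rw [← AdjoinRoot.aeval_eq, ← aeval_algHom_apply, aeval_def]
    rw [h3, h3]
  · rw [as_iff_trace, Algebra.trace_trace, ← as_iff_trace]
    unfold hasseSolvable
    constructor
    · rintro ⟨x, hx⟩
      refine ⟨AdjoinRoot.mk P x, ?_⟩
      rw [← AdjoinRoot.mk_eq_zero, map_sub, sub_eq_zero] at hx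
      rw [eq_div_iff hd, ← hx]
      simp
    · rintro ⟨x, hx⟩
      obtain ⟨x, rfl⟩ := AdjoinRoot.mk_surjective x
      refine ⟨x, ?_⟩
      rw [← AdjoinRoot.mk_eq_zero, map_sub, sub_eq_zero]
      rw [eq_div_iff hd] at hx
      rw [← hx]
      simp

/-- The symbol is the additive character of the root sum. -/
theorem quadSym_eq [CharP Fq 2] {f : Polynomial Fq} (hf : f.Monic) {u : RatFunc Fq}
    (h : IsCoprime f u.denom) :
    ∃ t : Fq, algebraMap Fq (Lc Fq) t = Lam f u ∧ quadSym u f = psi t := by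
  classical
  unfold quadSym
  rw [if_pos h]
  have key : ∀ s : Multiset (Polynomial Fq), (∀ P ∈ s, Irreducible P ∧ IsCoprime P u.denom) →
      ∃ t : Fq, algebraMap Fq (Lc Fq) t = Lam s.prod u ∧
        (s.map fun P => if hasseSolvable u P then (1 : ℤ) else -1).prod = psi t := by
    intro s
    induction s using Multiset.induction_on with
    | empty =>
      intro _
      refine ⟨0, ?_, ?_⟩
      · simp [Lam]
      · simp [psi_zero]
    | cons P s ih =>
      intro hs
      obtain ⟨t, h1, h2⟩ := ih (fun Q hQ => hs Q (Multiset.mem_cons_of_mem hQ))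
      obtain ⟨hP, hPu⟩ := hs P (Multiset.mem_cons_self P s)
      obtain ⟨t', h1', h2'⟩ := sgn_prime hP hPu
      refine ⟨t' + t, ?_, ?_⟩
      · rw [map_add, h1, h1']
        unfold Lam
        rw [Multiset.prod_cons, aroots_mul, Multiset.map_add, Multiset.sum_add]
        refine mul_ne_zero hP.ne_zero ?_
        apply Multiset.prod_ne_zero
        intro h0
        exact (hs 0 (Multiset.mem_cons_of_mem h0)).1.ne_zero rfl
      · rw [Multiset.map_cons, Multiset.prod_cons, h2, psi_add]
        congr 1
        simp only [psi, h2']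
  obtain ⟨t, h1, h2⟩ := key (normalizedFactors f) (fun P hP =>
    ⟨irreducible_of_normalized_factor P hP,
      h.of_isCoprime_of_dvd_left (dvd_of_mem_normalizedFactors hP)⟩)
  refine ⟨t, ?_, h2⟩
  rw [h1]
  congr 1
  have := prod_normalizedFactors_eq hf.ne_zero
  rw [this, hf.normalize_eq_self]

end EvenChar

namespace EvenChar

variable {Fq : Type} [Field Fq] [Fintype Fq]

/-- The coercion from polynomials to rational functions. -/
abbrev ι (p : Polynomial Fq) : RatFunc Fq := algebraMap (Polynomial Fq) (RatFunc Fq) p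

theorem cop_add {f : Polynomial Fq} {u v : RatFunc Fq} (hu : IsCoprime f u.denom)
    (hv : IsCoprime f v.denom) : IsCoprime f (u + v).denom :=
  (hu.mul_right hv).of_isCoprime_of_dvd_right (RatFunc.denom_add_dvd u v)

theorem cop_mul {f : Polynomial Fq} {u v : RatFunc Fq} (hu : IsCoprime f u.denom)
    (hv : IsCoprime f v.denom) : IsCoprime f (u * v).denom :=
  (hu.mul_right hv).of_isCoprime_of_dvd_right (RatFunc.denom_mul_dvd u v)

theorem cop_poly (f p : Polynomial Fq) : IsCoprime f (ι p).denom := by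
  rw [ι, RatFunc.denom_algebraMap]
  exact isCoprime_one_right

theorem cop_div {f p q : Polynomial Fq} (hq : q ≠ 0) (h : IsCoprime f q) :
    IsCoprime f (ι p / ι q).denom :=
  h.of_isCoprime_of_dvd_right (RatFunc.denom_div_dvd p q)

theorem cop_neg {f : Polynomial Fq} {u : RatFunc Fq} (hu : IsCoprime f u.denom) :
    IsCoprime f (-u).denom := by
  have : -u = ι (-1) * u := by simp [ι]
  rw [this]
  exact cop_mul (cop_poly _ _) hu

theorem cop_sum {α : Type} {f : Polynomial Fq} {s : Finset α} {u : α → RatFunc Fq}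
    (h : ∀ i ∈ s, IsCoprime f (u i).denom) : IsCoprime f (∑ i ∈ s, u i).denom := by
  classical
  induction s using Finset.induction_on with
  | empty => simpa [ι] using cop_poly f 0
  | insert a s ha ih =>
    rw [Finset.sum_insert ha]
    exact cop_add (h a (Finset.mem_insert_self a s))
      (ih (fun i hi => h i (Finset.mem_insert_of_mem hi)))

theorem Lam_add {f : Polynomial Fq} {u v : RatFunc Fq} (hu : IsCoprime f u.denom)
    (hv : IsCoprime f v.denom) : Lam f (u + v) = Lam f u + Lam f v := by
  unfold Lam
  rw [← Multiset.sum_map_add]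
  congr 1
  apply Multiset.map_congr rfl
  intro θ hθ
  exact RatFunc.eval_add _ _ (denom_ne_of_coprime hu hθ) (denom_ne_of_coprime hv hθ)

theorem Lam_zero (f : Polynomial Fq) : Lam f 0 = 0 := by
  simp [Lam, ev]

theorem Lam_poly (f p : Polynomial Fq) :
    Lam f (ι p) = ((f.aroots (Lc Fq)).map fun θ => aeval θ p).sum := by
  unfold Lam
  congr 1
  apply Multiset.map_congr rfl
  intro θ hθ
  simp [ev, aeval_def]

theorem Lam_div {f p q : Polynomial Fq} (h : IsCoprime f q) (hq : q ≠ 0) :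
    Lam f (ι p / ι q) = ((f.aroots (Lc Fq)).map fun θ => aeval θ p / aeval θ q).sum := by
  unfold Lam
  congr 1
  apply Multiset.map_congr rfl
  intro θ hθ
  have hq0 : ι q ≠ 0 := RatFunc.algebraMap_ne_zero hq
  have h1 : ev θ (ι p) = ev θ (ι p / ι q) * ev θ (ι q) := by
    unfold ev
    rw [← RatFunc.eval_mul _ _ (denom_ne_of_coprime (cop_div hq h) hθ)
      (denom_ne_of_coprime (cop_poly _ _) hθ), div_mul_cancel₀ _ hq0]
  have h2 : ∀ r : Polynomial Fq, ev θ (ι r) = aeval θ r := by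
    intro r; simp [ev, aeval_def]
  rw [h2, h2] at h1
  rw [eq_div_iff, h1]
  intro h0
  obtain ⟨a, b, hab⟩ := h
  have h1 := (mem_aroots'.mp hθ).2
  have := congrArg (aeval θ) hab
  rw [map_add, map_mul, map_mul, h1, h0] at this
  simp at this

theorem Lam_sq [CharP Fq 2] {f : Polynomial Fq} {u : RatFunc Fq} (hu : IsCoprime f u.denom) :
    Lam f (u * u) = Lam f u ^ 2 := by
  haveI : CharP (Lc Fq) 2 := charP_of_injective_algebraMap (algebraMap Fq (Lc Fq)).injective 2
  haveI : ExpChar (Lc Fq) 2 := ExpChar.prime Nat.prime_two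
  rw [← frobenius_def]
  unfold Lam
  rw [map_multiset_sum, Multiset.map_map]
  congr 1
  apply Multiset.map_congr rfl
  intro θ hθ
  simp only [Function.comp, frobenius_def, pow_two]
  exact RatFunc.eval_mul _ _ (denom_ne_of_coprime hu hθ) (denom_ne_of_coprime hu hθ)

theorem cop_smul {f : Polynomial Fq} {u : RatFunc Fq} (c : Fq) (hu : IsCoprime f u.denom) :
    IsCoprime f (c • u).denom := by
  rw [Algebra.smul_def]
  exact cop_mul (cop_poly f (C c)) hu

theorem Lam_smul {f : Polynomial Fq} {u : RatFunc Fq} (c : Fq) (hu : IsCoprime f u.denom) :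
    Lam f (c • u) = algebraMap Fq (Lc Fq) c * Lam f u := by
  unfold Lam
  rw [← Multiset.sum_map_mul_left]
  congr 1
  apply Multiset.map_congr rfl
  intro θ hθ
  have : c • u = ι (C c) * u := by rw [Algebra.smul_def]; rfl
  rw [this]
  unfold ev
  rw [RatFunc.eval_mul _ _ (denom_ne_of_coprime (cop_poly _ _) hθ) (denom_ne_of_coprime hu hθ)]
  simp

theorem quadSym_add [CharP Fq 2] {f : Polynomial Fq} (hf : f.Monic) {u v : RatFunc Fq}
    (hu : IsCoprime f u.denom) (hv : IsCoprime f v.denom) :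
    quadSym (u + v) f = quadSym u f * quadSym v f := by
  obtain ⟨t, h1, h2⟩ := quadSym_eq hf hu
  obtain ⟨t', h1', h2'⟩ := quadSym_eq hf hv
  obtain ⟨t'', h1'', h2''⟩ := quadSym_eq hf (cop_add hu hv)
  have : t'' = t + t' := by
    apply (algebraMap Fq (Lc Fq)).injective
    rw [map_add, h1, h1', h1'', Lam_add hu hv]
  rw [h2, h2', h2'', this, psi_add]

theorem quadSym_add_poly [CharP Fq 2] {f : Polynomial Fq} (hf : f.Monic) (u : RatFunc Fq)
    (G : Polynomial Fq) :
    quadSym (u + ι G) f = quadSym u f * quadSym (ι G) f := by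
  by_cases hu : IsCoprime f u.denom
  · exact quadSym_add hf hu (cop_poly _ _)
  · have h1 : quadSym u f = 0 := by unfold quadSym; rw [if_neg hu]
    have h2 : quadSym (u + ι G) f = 0 := by
      unfold quadSym
      rw [if_neg]
      intro h
      apply hu
      have := cop_add h (cop_neg (cop_poly f G))
      rwa [add_neg_cancel_right] at this
    rw [h1, h2, zero_mul]

theorem quadSym_zero {f : Polynomial Fq} [CharP Fq 2] (hf : f.Monic) :
    quadSym (0 : RatFunc Fq) f = 1 := by
  have h0 : IsCoprime f (0 : RatFunc Fq).denom := by simpa [ι] using cop_poly f 0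
  obtain ⟨t, h1, h2⟩ := quadSym_eq hf h0
  rw [Lam_zero] at h1
  have : t = 0 := by simpa using h1
  rw [h2, this, psi_zero]

theorem quadSym_sum [CharP Fq 2] {α : Type} {f : Polynomial Fq} (hf : f.Monic) {s : Finset α}
    {u : α → RatFunc Fq}
    (h : ∀ i ∈ s, IsCoprime f (u i).denom) :
    quadSym (∑ i ∈ s, u i) f = ∏ i ∈ s, quadSym (u i) f := by
  classical
  induction s using Finset.induction_on with
  | empty => simpa using quadSym_zero hf
  | insert a s ha ih =>
    rw [Finset.sum_insert ha, Finset.prod_insert ha, quadSym_add hf (h a (Finset.mem_insert_self a s))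
      (cop_sum (fun i hi => h i (Finset.mem_insert_of_mem hi))),
      ih (fun i hi => h i (Finset.mem_insert_of_mem hi))]

theorem quadSym_abs {f : Polynomial Fq} [CharP Fq 2] (hf : f.Monic) (u : RatFunc Fq) :
    quadSym u f = 0 ∨ quadSym u f = 1 ∨ quadSym u f = -1 := by
  by_cases hu : IsCoprime f u.denom
  · obtain ⟨t, h1, h2⟩ := quadSym_eq hf hu
    right
    rw [h2]
    unfold psi
    split_ifs <;> simp
  · left
    unfold quadSym; rw [if_neg hu]

theorem Lam_of_triv [CharP Fq 2] {f : Polynomial Fq} (hf : f.Monic) {ξ : Fq}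
    (hξ : ∀ x : Fq, x ^ 2 + x ≠ ξ) (U : Submodule Fq (RatFunc Fq))
    (hU : ∀ u ∈ U, IsCoprime f u.denom) (h1 : ∀ u ∈ U, quadSym u f = 1) (u : RatFunc Fq)
    (hu : u ∈ U) : Lam f u = 0 := by
  obtain ⟨t, ht, -⟩ := quadSym_eq hf (hU u hu)
  by_contra hne
  have ht0 : t ≠ 0 := by
    rintro rfl
    exact hne (by rw [← ht, map_zero])
  have hm := U.smul_mem (ξ / t) hu
  obtain ⟨t', ht', hq⟩ := quadSym_eq hf (hU _ hm)
  rw [Lam_smul _ (hU u hu), ← ht, ← map_mul] at ht'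
  have h3 : t' = ξ := by
    have := (algebraMap Fq (Lc Fq)).injective ht'
    rw [this, div_mul_cancel₀ _ ht0]
  rw [h1 _ hm, h3] at hq
  unfold psi at hq
  rw [if_neg (by push Not; exact hξ)] at hq
  norm_num at hq

/-- Orthogonality for a finite group of rational functions prime to `f`. -/
theorem sum_group [CharP Fq 2] {f : Polynomial Fq} (hf : f.Monic) (U : Submodule Fq (RatFunc Fq))
    (hU : ∀ u ∈ U, IsCoprime f u.denom) (S : Finset (RatFunc Fq)) (hS : ∀ u, u ∈ S ↔ u ∈ U) :
    (∀ u ∈ U, quadSym u f = 1) ∨ ∑ u ∈ S, quadSym u f = 0 := by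
  by_cases h : ∀ u ∈ U, quadSym u f = 1
  · exact Or.inl h
  right
  push Not at h
  obtain ⟨w, hw, hw1⟩ := h
  have e : ∑ u ∈ S, quadSym u f = ∑ u ∈ S, quadSym (u + w) f := by
    symm
    apply Finset.sum_bij (fun u _ => u + w)
    · intro u hu
      rw [hS] at hu ⊢
      exact U.add_mem hu hw
    · intro a _ b _ h
      exact add_right_cancel h
    · intro b hb
      refine ⟨b - w, ?_, by ring⟩
      rw [hS] at hb ⊢
      exact U.sub_mem hb hw
    · intro u hu
      rfl
  have e2 : ∑ u ∈ S, quadSym (u + w) f = (∑ u ∈ S, quadSym u f) * quadSym w f := by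
    rw [Finset.sum_mul]
    apply Finset.sum_congr rfl
    intro u hu
    exact quadSym_add hf (hU u ((hS u).mp hu)) (hU w hw)
  rw [e2] at e
  have : (∑ u ∈ S, quadSym u f) * (quadSym w f - 1) = 0 := by linarith
  rcases mul_eq_zero.mp this with h | h
  · exact h
  · exact absurd (by linarith) hw1

theorem sum_diff [CharP Fq 2] {f : Polynomial Fq} (hf : f.Monic) (U U' : Submodule Fq (RatFunc Fq))
    (hle : U' ≤ U)
    (hU : ∀ u ∈ U, IsCoprime f u.denom) (hfin : (U : Set (RatFunc Fq)).Finite)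
    (S : Finset (RatFunc Fq)) (hS : ∀ u, u ∈ S ↔ u ∈ U ∧ u ∉ U') :
    ((∀ u ∈ U, quadSym u f = 1) ∧ |∑ u ∈ S, quadSym u f| ≤ (U : Set (RatFunc Fq)).ncard) ∨
    ((∀ u ∈ U', quadSym u f = 1) ∧ |∑ u ∈ S, quadSym u f| ≤ (U' : Set (RatFunc Fq)).ncard) ∨
    ∑ u ∈ S, quadSym u f = 0 := by
  classical
  have bd : ∀ (A : Finset (RatFunc Fq)), |∑ u ∈ A, quadSym u f| ≤ A.card := by
    intro A
    refine (Finset.abs_sum_le_sum_abs _ _).trans ?_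
    refine (Finset.sum_le_card_nsmul A _ 1 ?_).trans (by simp)
    intro u _
    rcases quadSym_abs hf u with h | h | h <;> rw [h] <;> norm_num
  have hfin' : (U' : Set (RatFunc Fq)).Finite := hfin.subset hle
  have hsum : ∑ u ∈ S, quadSym u f + ∑ u ∈ hfin'.toFinset, quadSym u f
      = ∑ u ∈ hfin.toFinset, quadSym u f := by
    rw [← Finset.sum_union]
    · congr 1
      ext u
      simp only [Finset.mem_union, hS, Set.Finite.mem_toFinset, SetLike.mem_coe]
      have := @hle u
      tauto
    · rw [Finset.disjoint_left]
      intro u hu hu'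
      rw [hS] at hu
      exact hu.2 (by simpa using hu')
  by_cases h : ∀ u ∈ U, quadSym u f = 1
  · left
    refine ⟨h, (bd S).trans ?_⟩
    rw [Set.ncard_eq_toFinset_card _ hfin]
    norm_cast
    apply Finset.card_le_card
    intro u hu
    rw [hS] at hu
    simpa using hu.1
  · right
    rcases sum_group hf U hU hfin.toFinset (by simp) with h' | h'
    · exact absurd h' h
    rcases sum_group hf U' (fun u hu => hU u (hle hu)) hfin'.toFinset (by simp) with h2 | h2
    · left
      refine ⟨h2, ?_⟩
      rw [h'] at hsum
      rw [eq_neg_of_add_eq_zero_left hsum, abs_neg, Set.ncard_eq_toFinset_card _ hfin']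
      exact bd _
    · right
      rw [h', h2] at hsum
      simpa using hsum

end EvenChar

namespace EvenChar

variable {Fq : Type} [Field Fq] [Fintype Fq]

theorem fac_root {L : Type} [Field L] {p : Polynomial L} {θ : L} (h : p.IsRoot θ) :
    p = (X - C θ) * (p /ₘ (X - C θ)) := (mul_divByMonic_eq_iff_isRoot.mpr h).symm

theorem derivative_roots {f : Polynomial Fq} (hf : f.Monic) :
    derivative (f.map (algebraMap Fq (Lc Fq))) =
      ((f.aroots (Lc Fq)).map fun θ => f.map (algebraMap Fq (Lc Fq)) /ₘ (X - C θ)).sum := by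
  classical
  set F := f.map (algebraMap Fq (Lc Fq)) with hF
  have hs : F.Splits := IsAlgClosed.splits _
  have hm : F.Monic := hf.map _
  have hprod : F = (F.roots.map fun θ => X - C θ).prod := hs.eq_prod_roots_of_monic hm
  have hroots : f.aroots (Lc Fq) = F.roots := rfl
  rw [hroots]
  conv_lhs => rw [hprod]
  rw [derivative_prod]
  congr 1
  apply Multiset.map_congr rfl
  intro θ hθ
  have h1 : F = (X - C θ) * ((F.roots.erase θ).map fun θ => X - C θ).prod := by
    conv_lhs => rw [hprod, ← Multiset.cons_erase hθ]
    rw [Multiset.map_cons, Multiset.prod_cons]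
  have h2 := fac_root (mem_roots'.mp hθ).2
  have := mul_left_cancel₀ (X_sub_C_ne_zero θ) (h2.symm.trans h1)
  rw [this]
  simp

theorem coeff_multiset_sum' {L α : Type} [Field L] (s : Multiset α) (g : α → Polynomial L) (n : ℕ) :
    ((s.map g).sum).coeff n = (s.map fun a => (g a).coeff n).sum := by
  have := map_multiset_sum (lcoeff L n) (s.map g)
  rw [Multiset.map_map] at this
  exact this

theorem coeff_derivative_zero {f : Polynomial Fq} (hf : f.Monic) {J : ℕ}
    (hJ : ∀ j < J, Lam f (ι (X ^ j)) = 0) (n : ℕ) (hn : f.natDegree ≤ n + J) :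
    (derivative f).coeff n = 0 := by
  apply (algebraMap Fq (Lc Fq)).injective
  rw [map_zero, ← coeff_map, ← derivative_map, derivative_roots hf, coeff_multiset_sum']
  simp only [coeff_divByMonic_X_sub_C]
  rw [Multiset.sum_map_sum]
  apply Finset.sum_eq_zero
  intro i hi
  rw [Finset.mem_Icc, natDegree_map] at hi
  rw [Multiset.sum_map_mul_right]
  have := hJ (i - (n + 1)) (by omega)
  rw [Lam_poly] at this
  simp only [map_pow, aeval_X] at this
  rw [this, zero_mul]

theorem dvd_derivative {f Y : Polynomial Fq} (hf : f.Monic) (hY : Y ≠ 0) (hc : IsCoprime f Y)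
    (h : ∀ D : Polynomial Fq, D.degree < Y.degree → Lam f (ι D / ι Y) = 0) :
    Y ∣ derivative f := by
  set F := f.map (algebraMap Fq (Lc Fq)) with hF
  set Z := Y.map (algebraMap Fq (Lc Fq)) with hZ
  have hroots : f.aroots (Lc Fq) = F.roots := rfl
  have hne : ∀ θ ∈ F.roots, Z.eval θ ≠ 0 := by
    intro θ hθ h0
    obtain ⟨a, b, hab⟩ := hc
    have h1 := (mem_aroots'.mp (hroots ▸ hθ)).2
    have := congrArg (aeval θ) hab
    rw [hZ, eval_map, ← aeval_def] at h0
    rw [map_add, map_mul, map_mul, h1, h0] at this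
    simp at this
  have e1 : Z * (F.roots.map fun θ => C (Z.eval θ)⁻¹ * (F /ₘ (X - C θ))).sum =
      F * (F.roots.map fun θ => C (Z.eval θ)⁻¹ * (Z /ₘ (X - C θ))).sum + derivative F := by
    rw [derivative_roots hf, hroots, ← Multiset.sum_map_mul_left, ← Multiset.sum_map_mul_left,
      ← Multiset.sum_map_add]
    congr 1
    apply Multiset.map_congr rfl
    intro θ hθ
    have h2 := fac_root (mem_roots'.mp hθ).2
    have h3 : Z = C (Z.eval θ) + (X - C θ) * (Z /ₘ (X - C θ)) := by
      conv_lhs => rw [← modByMonic_add_div Z (X - C θ), modByMonic_X_sub_C_eq_C_eval]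
    have h4 : C (Z.eval θ) * C (Z.eval θ)⁻¹ = (1 : Polynomial (Lc Fq)) := by
      rw [← C_mul, mul_inv_cancel₀ (hne θ hθ), C_1]
    set c := (Z.eval θ) with hcdef
    set F1 := F /ₘ (X - C θ)
    set Z1 := Z /ₘ (X - C θ)
    calc Z * (C c⁻¹ * F1) = (C c + (X - C θ) * Z1) * (C c⁻¹ * F1) := by rw [← h3]
      _ = ((X - C θ) * F1) * (C c⁻¹ * Z1) + (C c * C c⁻¹) * F1 := by ring
      _ = _ := by rw [h4, ← h2, one_mul]
  have e2 : (F.roots.map fun θ => C (Z.eval θ)⁻¹ * (Z /ₘ (X - C θ))).sum = 0 := by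
    ext n
    rw [coeff_multiset_sum', coeff_zero]
    set D : Polynomial Fq := ∑ i ∈ Finset.Icc (n + 1) Y.natDegree, C (Y.coeff i) * X ^ (i - (n + 1))
      with hD
    have hdeg : D.degree < Y.degree := by
      rw [hD]
      by_cases h0 : n + 1 ≤ Y.natDegree
      · refine lt_of_le_of_lt (degree_sum_le _ _) ?_
        rw [Finset.sup_lt_iff (bot_lt_iff_ne_bot.mpr (by simpa using hY))]
        intro i hi
        rw [Finset.mem_Icc] at hi
        refine lt_of_le_of_lt (degree_C_mul_X_pow_le _ _) ?_
        rw [degree_eq_natDegree hY]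
        norm_cast
        omega
      · rw [Finset.Icc_eq_empty h0, Finset.sum_empty, degree_zero]
        exact bot_lt_iff_ne_bot.mpr (by simpa using hY)
    have := h D hdeg
    rw [Lam_div hc hY, hroots] at this
    rw [← this]
    congr 1
    apply Multiset.map_congr rfl
    intro θ hθ
    rw [coeff_C_mul, coeff_divByMonic_X_sub_C, div_eq_inv_mul]
    congr 1
    · rw [hZ, eval_map, aeval_def]
    · rw [hD, map_sum, hZ, natDegree_map]
      apply Finset.sum_congr rfl
      intro i _
      rw [map_mul, aeval_C, map_pow, aeval_X, coeff_map, mul_comm]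
  rw [e2, mul_zero, zero_add] at e1
  have : Z ∣ (derivative f).map (algebraMap Fq (Lc Fq)) := by
    rw [← derivative_map]
    exact ⟨_, e1.symm⟩
  exact (map_dvd_map' _).mp this

theorem sq_of_derivative_zero [CharP Fq 2] {f : Polynomial Fq} (h : derivative f = 0) :
    ∃ w : Polynomial Fq, f = w ^ 2 := by
  haveI : Fact (Nat.Prime 2) := ⟨Nat.prime_two⟩
  haveI : ExpChar Fq 2 := ExpChar.prime Nat.prime_two
  have h1 := expand_contract 2 h two_ne_zero
  refine ⟨(contract 2 f).map (frobeniusEquiv Fq 2).symm.toRingHom, ?_⟩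
  rw [← map_frobenius_expand 2, map_expand, map_map]
  conv_lhs => rw [← h1]
  congr 1
  ext n
  simp [coeff_map]

theorem derivative_is_sq [CharP Fq 2] (f : Polynomial Fq) :
    ∃ b : Polynomial Fq, derivative f = b ^ 2 := by
  apply sq_of_derivative_zero
  ext n
  rw [coeff_derivative, coeff_derivative, coeff_zero, mul_assoc]
  have : ((n + 1 : ℕ) + 1 : Fq) * (n + 1 : Fq) = 0 := by
    have h2 : 2 ∣ (n + 1 + 1) * (n + 1) := by
      rw [mul_comm]; exact (Nat.even_mul_succ_self (n + 1)).two_dvd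
    have := (CharP.cast_eq_zero_iff Fq 2 _).mpr h2
    push_cast at this ⊢
    exact this
  rw [this, mul_zero]

end EvenChar

namespace EvenChar

variable {Fq : Type} [Field Fq] [Fintype Fq]

/-- The linear map `p ↦ p / P ^ k`. -/
def lin (P : Polynomial Fq) (k : ℕ) : Polynomial Fq →ₗ[Fq] RatFunc Fq where
  toFun p := ι p / ι P ^ k
  map_add' a b := by simp [ι, add_div]
  map_smul' c a := by simp [ι, Algebra.smul_def, mul_div_assoc, Polynomial.algebraMap_eq]

/-- The space of `P`-parts of order at most `e`. -/
def Wp (P : Polynomial Fq) : ℕ → Submodule Fq (RatFunc Fq)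
  | 0 => ⊥
  | e + 1 => Wp P e ⊔ (degreeLT Fq P.natDegree).map (lin P (2 * e + 1))

theorem Wp_succ_mem {P : Polynomial Fq} {e : ℕ} {u : RatFunc Fq} :
    u ∈ Wp P (e + 1) ↔ ∃ w ∈ Wp P e, ∃ a : Polynomial Fq, a ∈ degreeLT Fq P.natDegree ∧
      u = w + ι a / ι P ^ (2 * e + 1) := by
  change u ∈ Wp P e ⊔ (degreeLT Fq P.natDegree).map (lin P (2 * e + 1)) ↔ _
  rw [Submodule.mem_sup]
  constructor
  · rintro ⟨w, hw, _, ⟨a, ha, rfl⟩, rfl⟩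
    exact ⟨w, hw, a, ha, rfl⟩
  · rintro ⟨w, hw, a, ha, rfl⟩
    exact ⟨w, hw, _, ⟨a, ha, rfl⟩, rfl⟩

theorem Wp_le_succ (P : Polynomial Fq) (e : ℕ) : Wp P e ≤ Wp P (e + 1) := le_sup_left

theorem Wp_mono (P : Polynomial Fq) {e e' : ℕ} (h : e ≤ e') : Wp P e ≤ Wp P e' :=
  monotone_nat_of_le_succ (Wp_le_succ P) h

theorem degLT_iff {P a : Polynomial Fq} (hP : P ≠ 0) :
    a ∈ degreeLT Fq P.natDegree ↔ a.degree < P.degree := by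
  rw [mem_degreeLT, degree_eq_natDegree hP]

theorem Wp_fin (P : Polynomial Fq) (e : ℕ) :
    Module.Finite Fq (Wp P e) ∧ Module.finrank Fq (Wp P e) ≤ e * P.natDegree := by
  haveI : Module.Finite Fq (degreeLT Fq P.natDegree) :=
    Module.Finite.equiv (degreeLTEquiv Fq P.natDegree).symm
  have h1 : Module.finrank Fq (degreeLT Fq P.natDegree) = P.natDegree := by
    rw [(degreeLTEquiv Fq P.natDegree).finrank_eq]; simp
  induction e with
  | zero =>
    constructor
    · change Module.Finite Fq (⊥ : Submodule Fq (RatFunc Fq)); infer_instance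
    · change Module.finrank Fq (⊥ : Submodule Fq (RatFunc Fq)) ≤ _; simp
  | succ e ih =>
    obtain ⟨h2, h3⟩ := ih
    have h4 : Module.finrank Fq ((degreeLT Fq P.natDegree).map (lin P (2 * e + 1))) ≤ P.natDegree :=
      (Submodule.finrank_map_le _ _).trans h1.le
    constructor
    · change Module.Finite Fq (Wp P e ⊔ (degreeLT Fq P.natDegree).map (lin P (2 * e + 1)) :
        Submodule Fq (RatFunc Fq))
      infer_instance
    · have := Submodule.finrank_add_le_finrank_add_finrank (Wp P e)
        ((degreeLT Fq P.natDegree).map (lin P (2 * e + 1)))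
      change Module.finrank Fq (Wp P e ⊔ (degreeLT Fq P.natDegree).map (lin P (2 * e + 1)) :
        Submodule Fq (RatFunc Fq)) ≤ _
      rw [add_mul, one_mul]
      omega

theorem ncard_le_of_finrank (U : Submodule Fq (RatFunc Fq)) (n : ℕ) (h : Module.Finite Fq U)
    (h2 : Module.finrank Fq U ≤ n) :
    (U : Set (RatFunc Fq)).Finite ∧ (U : Set (RatFunc Fq)).ncard ≤ Fintype.card Fq ^ n := by
  haveI : Finite U := Module.finite_of_finite Fq
  refine ⟨Set.toFinite _, ?_⟩
  have h3 : (U : Set (RatFunc Fq)).ncard = Nat.card U := rfl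
  rw [h3, Module.natCard_eq_pow_finrank (K := Fq), Nat.card_eq_fintype_card]
  exact Nat.pow_le_pow_right Fintype.card_pos h2

theorem Wp_finite (P : Polynomial Fq) (e : ℕ) : (Wp P e : Set (RatFunc Fq)).Finite :=
  (ncard_le_of_finrank _ _ (Wp_fin P e).1 (Wp_fin P e).2).1

theorem Wp_card (P : Polynomial Fq) (e : ℕ) :
    (Wp P e : Set (RatFunc Fq)).ncard ≤ Fintype.card Fq ^ (e * P.natDegree) :=
  (ncard_le_of_finrank _ _ (Wp_fin P e).1 (Wp_fin P e).2).2

theorem Wp_num {P : Polynomial Fq} (hP : P ≠ 0) (hdP : 0 < P.natDegree)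
    (e : ℕ) (u : RatFunc Fq) (hu : u ∈ Wp P e) :
    ∃ B : Polynomial Fq, u = ι B / ι P ^ (2 * e) ∧ B.degree < (P ^ (2 * e)).degree ∧ P ∣ B := by
  have hι : ι P ≠ 0 := RatFunc.algebraMap_ne_zero hP
  induction e generalizing u with
  | zero =>
    have : u = 0 := by simpa [Wp] using hu
    refine ⟨0, by simp [this, ι], by simp, dvd_zero _⟩
  | succ e ih =>
    obtain ⟨w, hw, a, ha, rfl⟩ := Wp_succ_mem.mp hu
    obtain ⟨B, rfl, hB, hPB⟩ := ih w hw
    rw [degLT_iff hP] at ha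
    refine ⟨B * P ^ 2 + a * P, ?_, ?_, ?_⟩
    · simp only [ι, map_add, map_mul, map_pow] at hι ⊢
      field_simp
      ring
    · have hne : P ^ (2 * e) ≠ 0 := pow_ne_zero _ hP
      have hpd : P.degree ≠ ⊥ := by simpa using hP
      have e1 : 2 * (e + 1) = 2 * e + 2 := by ring
      rw [e1, pow_add]
      refine lt_of_le_of_lt (degree_add_le _ _) (max_lt ?_ ?_)
      · rw [degree_mul, degree_mul]
        exact WithBot.add_lt_add_right (degree_eq_bot.not.mpr (pow_ne_zero 2 hP)) hB
      · rw [degree_mul, degree_mul, pow_two P, degree_mul, ← add_assoc]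
        refine WithBot.add_lt_add_right hpd ?_
        refine lt_of_lt_of_le ha ?_
        rw [degree_eq_natDegree hP, degree_eq_natDegree hne]
        norm_cast
        omega
    · exact dvd_add (Dvd.dvd.mul_left (dvd_pow_self P two_ne_zero) B) (dvd_mul_left P a)

theorem Wp_new {P : Polynomial Fq} (hP : Irreducible P) {e : ℕ} {w : RatFunc Fq} (hw : w ∈ Wp P e)
    {a : Polynomial Fq} (ha : a.degree < P.degree) (ha0 : a ≠ 0) :
    w + ι a / ι P ^ (2 * e + 1) ∉ Wp P e := by
  intro h
  have h2 : ι a / ι P ^ (2 * e + 1) ∈ Wp P e := by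
    have := (Wp P e).sub_mem h hw
    rwa [add_sub_cancel_left] at this
  obtain ⟨B, h3, -, -⟩ := Wp_num hP.ne_zero hP.natDegree_pos e _ h2
  have hι : ι P ≠ 0 := RatFunc.algebraMap_ne_zero hP.ne_zero
  have h4 : ι a = ι (B * P) := by
    simp only [ι, map_mul] at *
    rw [div_eq_div_iff (pow_ne_zero _ hι) (pow_ne_zero _ hι), pow_succ] at h3
    have h5 : algebraMap (Polynomial Fq) (RatFunc Fq) P ^ (2 * e) ≠ 0 := pow_ne_zero _ hι
    apply mul_right_cancel₀ h5
    rw [h3]; ring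
  have h5 : a = B * P := RatFunc.algebraMap_injective Fq h4
  have : P ∣ a := ⟨B, by rw [h5, mul_comm]⟩
  exact absurd (degree_le_of_dvd this ha0) (not_le.mpr ha)

theorem Wp_pole {P : Polynomial Fq} (hP : Irreducible P) {e : ℕ} {u : RatFunc Fq}
    (hu : u ∈ Wp P e) (hc : IsCoprime P u.denom) : u = 0 := by
  obtain ⟨B, h1, h2, -⟩ := Wp_num hP.ne_zero hP.natDegree_pos e _ hu
  have hι : ι P ≠ 0 := RatFunc.algebraMap_ne_zero hP.ne_zero
  have h3 : u.num * P ^ (2 * e) = B * u.denom := by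
    apply RatFunc.algebraMap_injective Fq
    have h4 := RatFunc.num_div_denom u
    have hd : ι u.denom ≠ 0 := RatFunc.algebraMap_ne_zero u.denom_ne_zero
    have h5 : ι u.num / ι u.denom = ι B / ι P ^ (2 * e) := h4.trans h1
    rw [div_eq_div_iff hd (pow_ne_zero _ hι)] at h5
    simpa [ι] using h5
  have h4 : P ^ (2 * e) ∣ B := by
    have : IsCoprime (P ^ (2 * e)) u.denom := hc.pow_left
    exact this.dvd_of_dvd_mul_right ⟨u.num, by rw [← h3, mul_comm]⟩
  have h5 : B = 0 := by
    by_contra hB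
    exact absurd (degree_le_of_dvd h4 hB) (not_le.mpr h2)
  rw [h1, h5]; simp [ι]

theorem Wp_cop {P : Polynomial Fq} (hP : Irreducible P) {e : ℕ} {u : RatFunc Fq}
    (hu : u ∈ Wp P e) {f : Polynomial Fq} (hc : IsCoprime f P) : IsCoprime f u.denom := by
  obtain ⟨B, h1, h2, -⟩ := Wp_num hP.ne_zero hP.natDegree_pos e _ hu
  have : u = ι B / ι (P ^ (2 * e)) := by rw [h1]; simp [ι]
  rw [this]
  exact cop_div (pow_ne_zero _ hP.ne_zero) hc.pow_right

theorem exists_sqrt_mod [CharP Fq 2] {P : Polynomial Fq} (hP : Irreducible P) (hm : P.Monic)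
    (A : Polynomial Fq) : ∃ B : Polynomial Fq, B.degree < P.degree ∧ P ∣ A - B * B := by
  haveI : Fact (Irreducible P) := ⟨hP⟩
  haveI : Module.Finite Fq (AdjoinRoot P) := (AdjoinRoot.powerBasis hP.ne_zero).finite
  haveI : Finite (AdjoinRoot P) := Module.finite_of_finite Fq
  haveI : CharP (AdjoinRoot P) 2 :=
    charP_of_injective_algebraMap (algebraMap Fq (AdjoinRoot P)).injective 2
  haveI : ExpChar (AdjoinRoot P) 2 := ExpChar.prime Nat.prime_two
  obtain ⟨y, hy⟩ := (frobeniusEquiv (AdjoinRoot P) 2).surjective (AdjoinRoot.mk P A)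
  obtain ⟨B, rfl⟩ := AdjoinRoot.mk_surjective y
  refine ⟨B %ₘ P, degree_modByMonic_lt B hm, ?_⟩
  rw [← AdjoinRoot.mk_eq_zero, map_sub, map_mul, ← hy, sub_eq_zero]
  have : AdjoinRoot.mk P (B %ₘ P) = AdjoinRoot.mk P B := by
    rw [AdjoinRoot.mk_eq_mk]
    refine ⟨-(B /ₘ P), ?_⟩
    have := modByMonic_add_div B P
    linear_combination this
  rw [this, frobeniusEquiv_apply, frobenius_def, pow_two]

theorem Wp_triv [CharP Fq 2] {f P : Polynomial Fq} (hf : f.Monic) (hP : Irreducible P)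
    (hm : P.Monic) (hc : IsCoprime f P) {e : ℕ} (h : ∀ u ∈ Wp P e, Lam f u = 0) :
    P ^ (2 * e) ∣ derivative f := by
  have hι : ι P ≠ 0 := RatFunc.algebraMap_ne_zero hP.ne_zero
  have hcop : ∀ (A : Polynomial Fq) (j : ℕ), IsCoprime f (ι A / ι P ^ j).denom := by
    intro A j
    have : ι A / ι P ^ j = ι A / ι (P ^ j) := by simp [ι]
    rw [this]
    exact cop_div (pow_ne_zero _ hP.ne_zero) hc.pow_right
  have h1 : ∀ j, 1 ≤ j → j ≤ 2 * e → ∀ A : Polynomial Fq, A.degree < P.degree →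
      Lam f (ι A / ι P ^ j) = 0 := by
    intro j
    induction j using Nat.strong_induction_on with
    | _ j ih =>
      intro hj1 hj2 A hA
      rcases Nat.even_or_odd' j with ⟨i, hi | hi⟩
      · obtain ⟨B, hB, Cc, hC⟩ := exists_sqrt_mod hP hm A
        have hCd : Cc.degree < P.degree := by
          by_contra hge
          rw [not_lt] at hge
          have hC0 : Cc ≠ 0 := by
            rintro rfl
            rw [degree_zero] at hge
            exact hP.ne_zero (degree_eq_bot.mp (le_bot_iff.mp hge))
          have hle : (P * Cc).degree < P.degree + P.degree := by
            rw [← hC]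
            have hpb : P.degree ≠ ⊥ := by simpa using hP.ne_zero
            refine lt_of_le_of_lt (degree_sub_le _ _) (max_lt ?_ ?_)
            · refine lt_of_lt_of_le hA ?_
              rw [degree_eq_natDegree hP.ne_zero]
              norm_cast
              omega
            · rw [degree_mul]
              by_cases hB0 : B = 0
              · rw [hB0, degree_zero, degree_eq_natDegree hP.ne_zero]
                simp only [WithBot.bot_add]
                exact WithBot.bot_lt_coe _
              · rw [degree_eq_natDegree hB0, degree_eq_natDegree hP.ne_zero] at *
                norm_cast at *
                omega
          rw [degree_mul, degree_eq_natDegree hP.ne_zero, degree_eq_natDegree hC0] at *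
          norm_cast at *
          omega
        have hdec : ι A / ι P ^ j = (ι B / ι P ^ i) * (ι B / ι P ^ i) + ι Cc / ι P ^ (j - 1) := by
          have hA' : A = B * B + P * Cc := by rw [← hC]; ring
          obtain ⟨k, rfl⟩ : ∃ k, i = k + 1 := ⟨i - 1, by omega⟩
          have hj' : j - 1 = 2 * k + 1 := by omega
          have hj'' : j = 2 * k + 2 := by omega
          rw [hj', hj'', hA']
          simp only [ι, map_add, map_mul] at hι ⊢
          field_simp
          ring
        rw [hdec, Lam_add (cop_mul (hcop _ _) (hcop _ _)) (hcop _ _), Lam_sq (hcop _ _),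
          ih i (by omega) (by omega) (by omega) B hB,
          ih (j - 1) (by omega) (by omega) (by omega) Cc hCd]
        simp
      · apply h
        apply Wp_mono P (show i + 1 ≤ e by omega)
        rw [Wp_succ_mem]
        exact ⟨0, Submodule.zero_mem _, A, (degLT_iff hP.ne_zero).mpr hA, by rw [hi, zero_add]⟩
  have h2 : ∀ j, j ≤ 2 * e → ∀ D : Polynomial Fq, D.degree < (P ^ j).degree →
      Lam f (ι D / ι P ^ j) = 0 := by
    intro j
    induction j with
    | zero =>
      intro _ D hD
      have : D = 0 := by
        rw [pow_zero, degree_one] at hD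
        exact degree_eq_bot.mp (Nat.WithBot.lt_zero_iff.mp hD)
      rw [this]
      simp [ι, Lam_zero]
    | succ j ih =>
      intro hj D hD
      have hdec : ι D / ι P ^ (j + 1) = ι (D %ₘ P) / ι P ^ (j + 1) + ι (D /ₘ P) / ι P ^ j := by
        conv_lhs => rw [← modByMonic_add_div D P]
        simp only [ι, map_add, map_mul] at hι ⊢
        field_simp
        ring
      rw [hdec, Lam_add (hcop _ _) (hcop _ _), h1 (j + 1) (by omega) hj _ (degree_modByMonic_lt D hm),
        zero_add]
      apply ih (by omega)
      by_cases hlt : D.degree < P.degree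
      · rw [(divByMonic_eq_zero_iff hm).mpr hlt, degree_zero]
        exact bot_lt_iff_ne_bot.mpr (degree_eq_bot.not.mpr (pow_ne_zero j hP.ne_zero))
      · have h5 := degree_add_divByMonic hm (not_lt.mp hlt)
        rw [← h5, pow_succ, degree_mul, add_comm] at hD
        exact lt_of_add_lt_add_right hD
  apply dvd_derivative hf (pow_ne_zero _ hP.ne_zero) hc.pow_right
  intro D hD
  have := h2 (2 * e) le_rfl D hD
  simpa [ι] using this

/-- `P`-parts of exact order `e`. -/
def Vf (P : Polynomial Fq) (e : ℕ) : Finset (RatFunc Fq) :=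
  ((Wp_finite P e).subset (Set.diff_subset (t := (Wp P (e - 1) : Set (RatFunc Fq))))).toFinset

theorem mem_Vf {P : Polynomial Fq} {e : ℕ} {u : RatFunc Fq} :
    u ∈ Vf P e ↔ u ∈ Wp P e ∧ u ∉ Wp P (e - 1) := by
  simp [Vf]

theorem local_bound [CharP Fq 2] {f P b : Polynomial Fq} (hf : f.Monic) (hb : derivative f = b ^ 2)
    {ξ : Fq} (hξ : ∀ x : Fq, x ^ 2 + x ≠ ξ)
    (hP : Irreducible P) (hm : P.Monic) (hc : IsCoprime f P) (e : ℕ) :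
    ∃ k, k ≤ e ∧ P ^ k ∣ b ∧
      |∑ u ∈ Vf P e, quadSym u f| ≤ (Fintype.card Fq : ℤ) ^ (k * P.natDegree) := by
  have key : ∀ k, (∀ u ∈ Wp P k, quadSym u f = 1) → P ^ k ∣ b := by
    intro k hk
    have h1 := Wp_triv hf hP hm hc
      (Lam_of_triv hf hξ (Wp P k) (fun u hu => Wp_cop hP hu hc) hk)
    rw [hb, mul_comm, pow_mul] at h1
    exact (UniqueFactorizationMonoid.pow_dvd_pow_iff_dvd two_ne_zero).mp h1
  rcases sum_diff hf (Wp P e) (Wp P (e - 1)) (Wp_mono P (by omega))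
    (fun u hu => Wp_cop hP hu hc) (Wp_finite P e) (Vf P e) (fun u => mem_Vf) with h | h | h
  · refine ⟨e, le_rfl, key e h.1, h.2.trans ?_⟩
    exact_mod_cast Wp_card P e
  · refine ⟨e - 1, by omega, key _ h.1, h.2.trans ?_⟩
    exact_mod_cast Wp_card P (e - 1)
  · refine ⟨0, by omega, by simp, ?_⟩
    rw [h]; simp

end EvenChar

namespace EvenChar

variable {Fq : Type} [Field Fq] [Fintype Fq]

open scoped Classical in
/-- The multiset of monic prime factors. -/
def nf (N : Polynomial Fq) : Multiset (Polynomial Fq) := normalizedFactors N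

theorem nf_mem {N P : Polynomial Fq} (hN : N ≠ 0) :
    P ∈ nf N ↔ Irreducible P ∧ P.Monic ∧ P ∣ N := by
  classical
  unfold nf
  rw [Polynomial.mem_normalizedFactors_iff hN]

theorem nf_prod {N : Polynomial Fq} (hN : N.Monic) : (nf N).prod = N := by
  classical
  unfold nf
  rw [prod_normalizedFactors_eq hN.ne_zero, hN.normalize_eq_self]

theorem nf_of_prod (m : Multiset (Polynomial Fq)) (h : ∀ P ∈ m, Irreducible P ∧ P.Monic) :
    nf m.prod = m := by
  classical
  unfold nf
  rw [normalizedFactors_prod_eq m (fun P hP => (h P hP).1)]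
  conv_rhs => rw [← Multiset.map_id m]
  apply Multiset.map_congr rfl
  intro P hP
  exact (h P hP).2.normalize_eq_self

theorem cop_of_ne {P Q : Polynomial Fq} (hP : Irreducible P) (hP' : P.Monic) (hQ : Irreducible Q)
    (hQ' : Q.Monic) (h : P ≠ Q) : IsCoprime P Q := by
  rcases hP.isCoprime_or_dvd Q with h1 | h1
  · exact h1
  · exact absurd (eq_of_monic_of_associated hP' hQ' (hP.associated_of_dvd hQ h1)) h

theorem part_zero (S : Finset (Polynomial Fq)) (hS : ∀ P ∈ S, Irreducible P ∧ P.Monic)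
    (w : Polynomial Fq → RatFunc Fq) (hw : ∀ P ∈ S, ∃ e, w P ∈ Wp P e) (Q : Polynomial Fq)
    (hQ : Q ∈ S) (hc : IsCoprime Q (∑ P ∈ S, w P).denom) : w Q = 0 := by
  classical
  obtain ⟨e, he⟩ := hw Q hQ
  apply Wp_pole (hS Q hQ).1 he
  have h1 : w Q = ∑ P ∈ S, w P + -(∑ P ∈ S.erase Q, w P) := by
    rw [← Finset.add_sum_erase S w hQ]; ring
  rw [h1]
  apply cop_add hc
  apply cop_neg
  apply cop_sum
  intro P hP
  rw [Finset.mem_erase] at hP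
  obtain ⟨e', he'⟩ := hw P hP.2
  exact Wp_cop (hS P hP.2).1 he'
    (cop_of_ne (hS Q hQ).1 (hS Q hQ).2 (hS P hP.2).1 (hS P hP.2).2 hP.1.symm)

theorem Vf_tuple {P : Polynomial Fq} (hP : Irreducible P) {e : ℕ} (he : 1 ≤ e) {u : RatFunc Fq} :
    u ∈ Vf P e ↔ ∃ a : ℕ → Polynomial Fq, (∀ i, 1 ≤ i → i ≤ e → (a i).degree < P.degree) ∧
      a e ≠ 0 ∧ u = ∑ i ∈ Finset.Icc 1 e, ι (a i) / ι P ^ (2 * i - 1) := by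
  have gen : ∀ e u, u ∈ Wp P e ↔ ∃ a : ℕ → Polynomial Fq,
      (∀ i, 1 ≤ i → i ≤ e → (a i).degree < P.degree) ∧
      u = ∑ i ∈ Finset.Icc 1 e, ι (a i) / ι P ^ (2 * i - 1) := by
    intro e
    induction e with
    | zero =>
      intro u
      constructor
      · intro h
        have : u = 0 := by simpa [Wp] using h
        exact ⟨fun _ => 0, by intros; omega, by simp [this]⟩
      · rintro ⟨a, -, rfl⟩
        simp
    | succ e ih =>
      intro u
      rw [Wp_succ_mem]
      constructor
      · rintro ⟨w, hw, a, ha, rfl⟩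
        obtain ⟨a', h1, h2⟩ := (ih w).mp hw
        refine ⟨fun i => if i = e + 1 then a else a' i, ?_, ?_⟩
        · intro i hi1 hi2
          dsimp only
          split_ifs with h
          · exact (degLT_iff hP.ne_zero).mp ha
          · exact h1 i hi1 (by omega)
        · rw [Finset.sum_Icc_succ_top (by omega)]
          dsimp only
          rw [if_pos rfl, h2]
          congr 1
          apply Finset.sum_congr rfl
          intro i hi
          rw [Finset.mem_Icc] at hi
          rw [if_neg (by omega)]
      · rintro ⟨a, h1, h2⟩
        refine ⟨_, (ih _).mpr ⟨a, fun i hi hi' => h1 i hi (by omega), rfl⟩, a (e + 1),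
          (degLT_iff hP.ne_zero).mpr (h1 (e + 1) (by omega) le_rfl), ?_⟩
        rw [h2, Finset.sum_Icc_succ_top (by omega)]
        rfl
  obtain ⟨e, rfl⟩ : ∃ k, e = k + 1 := ⟨e - 1, by omega⟩
  rw [mem_Vf, Nat.add_sub_cancel]
  constructor
  · rintro ⟨h1, h2⟩
    obtain ⟨a, h3, h4⟩ := (gen _ _).mp h1
    refine ⟨a, h3, ?_, h4⟩
    intro h0
    apply h2
    rw [gen]
    refine ⟨a, fun i hi hi' => h3 i hi (by omega), ?_⟩
    rw [h4, Finset.sum_Icc_succ_top (by omega), h0]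
    simp [ι]
  · rintro ⟨a, h1, h2, h3⟩
    refine ⟨(gen _ _).mpr ⟨a, h1, h3⟩, ?_⟩
    rw [h3, Finset.sum_Icc_succ_top (by omega)]
    apply Wp_new hP _ (h1 _ (by omega) le_rfl) h2
    exact (gen _ _).mpr ⟨a, fun i hi hi' => h1 i hi (by omega), rfl⟩

theorem Vf_ne_zero {P : Polynomial Fq} {e : ℕ} {u : RatFunc Fq} (hu : u ∈ Vf P e) : u ≠ 0 := by
  rintro rfl
  exact (mem_Vf.mp hu).2 (Submodule.zero_mem _)

theorem Vf_unique {P : Polynomial Fq} {e e' : ℕ} {u : RatFunc Fq} (hu : u ∈ Vf P e)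
    (hu' : u ∈ Vf P e') : e = e' := by
  rw [mem_Vf] at hu hu'
  rcases lt_trichotomy e e' with h | h | h
  · exact absurd (Wp_mono P (by omega) hu.1) hu'.2
  · exact h
  · exact absurd (Wp_mono P (by omega) hu'.1) hu.2

theorem monics_finite (r : ℕ) :
    {N : Polynomial Fq | N.Monic ∧ N.natDegree = r}.Finite ∧
    {N : Polynomial Fq | N.Monic ∧ N.natDegree = r}.ncard ≤ Fintype.card Fq ^ r := by
  let E := (monicEquivDegreeLT (R := Fq) r).trans (degreeLTEquiv Fq r).toEquiv
  haveI : Finite {N : Polynomial Fq // N.Monic ∧ N.natDegree = r} := Finite.of_equiv _ E.symm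
  refine ⟨Set.finite_coe_iff.mp (by exact this), ?_⟩
  have h3 : {N : Polynomial Fq | N.Monic ∧ N.natDegree = r}.ncard =
    Nat.card {N : Polynomial Fq // N.Monic ∧ N.natDegree = r} := rfl
  rw [h3, Nat.card_congr E]
  simp

/-- Monic polynomials of degree `r`. -/
def monics (Fq : Type) [Field Fq] [Fintype Fq] (r : ℕ) : Finset (Polynomial Fq) :=
  (monics_finite (Fq := Fq) r).1.toFinset

theorem mem_monics {r : ℕ} {N : Polynomial Fq} : N ∈ monics Fq r ↔ N.Monic ∧ N.natDegree = r := by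
  simp [monics]

open scoped Classical in
/-- The index set for the family `F_r`. -/
def Tidx (Fq : Type) [Field Fq] [Fintype Fq] (r : ℕ) :
    Finset (Σ N : Polynomial Fq, (P : Polynomial Fq) → P ∈ (nf N).toFinset → RatFunc Fq) :=
  (monics Fq r).sigma fun N => (nf N).toFinset.pi fun P => Vf P ((nf N).count P)

open scoped Classical in
/-- The rational function attached to an index. -/
def Phi (σ : Σ N : Polynomial Fq, (P : Polynomial Fq) → P ∈ (nf N).toFinset → RatFunc Fq) :
    RatFunc Fq := ∑ P ∈ (nf σ.1).toFinset.attach, σ.2 P.1 P.2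

open scoped Classical in
/-- Extension by zero of an index. -/
def exte {N : Polynomial Fq} (x : (P : Polynomial Fq) → P ∈ (nf N).toFinset → RatFunc Fq) :
    Polynomial Fq → RatFunc Fq := fun P => if h : P ∈ (nf N).toFinset then x P h else 0

open scoped Classical in
theorem Phi_eq (N : Polynomial Fq)
    (x : (P : Polynomial Fq) → P ∈ (nf N).toFinset → RatFunc Fq) :
    Phi ⟨N, x⟩ = ∑ P ∈ (nf N).toFinset, exte x P := by
  unfold Phi
  rw [← Finset.sum_attach (nf N).toFinset (exte x)]
  apply Finset.sum_congr rfl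
  intro P _
  unfold exte
  rw [dif_pos P.2]

open scoped Classical in
theorem Phi_inj_gen (r r' : ℕ) (g : Polynomial Fq)
    (σ σ' : Σ N : Polynomial Fq, (P : Polynomial Fq) → P ∈ (nf N).toFinset → RatFunc Fq)
    (hσ : σ ∈ Tidx Fq r) (hσ' : σ' ∈ Tidx Fq r') (heq : Phi σ = Phi σ' + ι g) : σ = σ' := by
  obtain ⟨N, x⟩ := σ
  obtain ⟨N', x'⟩ := σ'
  rw [Tidx, Finset.mem_sigma] at hσ hσ'
  obtain ⟨hN, hx⟩ := hσ
  obtain ⟨hN', hx'⟩ := hσ'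
  dsimp only at hN hx hN' hx'
  rw [mem_monics] at hN hN'
  rw [Finset.mem_pi] at hx hx'
  rw [Phi_eq, Phi_eq] at heq
  have ext1 : ∀ P, P ∈ (nf N).toFinset → exte x P ∈ Vf P ((nf N).count P) := by
    intro P h; unfold exte; rw [dif_pos h]; exact hx P h
  have ext1' : ∀ P, P ∈ (nf N').toFinset → exte x' P ∈ Vf P ((nf N').count P) := by
    intro P h; unfold exte; rw [dif_pos h]; exact hx' P h
  have ext0 : ∀ P, P ∉ (nf N).toFinset → exte x P = 0 := by
    intro P h; unfold exte; rw [dif_neg h]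
  have ext0' : ∀ P, P ∉ (nf N').toFinset → exte x' P = 0 := by
    intro P h; unfold exte; rw [dif_neg h]
  set S := (nf N).toFinset ∪ (nf N').toFinset with hSdef
  have hS : ∀ P ∈ S, Irreducible P ∧ P.Monic := by
    intro P hP
    rw [hSdef, Finset.mem_union, Multiset.mem_toFinset, Multiset.mem_toFinset,
      nf_mem hN.1.ne_zero, nf_mem hN'.1.ne_zero] at hP
    tauto
  have s1 : ∑ P ∈ (nf N).toFinset, exte x P = ∑ P ∈ S, exte x P :=
    Finset.sum_subset Finset.subset_union_left (fun P _ h => ext0 P h)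
  have s2 : ∑ P ∈ (nf N').toFinset, exte x' P = ∑ P ∈ S, exte x' P :=
    Finset.sum_subset Finset.subset_union_right (fun P _ h => ext0' P h)
  have hzero : ∑ P ∈ S, (exte x P - exte x' P) = ι g := by
    rw [Finset.sum_sub_distrib, ← s1, ← s2, heq, add_sub_cancel_left]
  have hall : ∀ P, exte x P = exte x' P := by
    intro P
    by_cases hP : P ∈ S
    · have := part_zero S hS (fun P => exte x P - exte x' P) (by
        intro Q hQ
        refine ⟨max ((nf N).count Q) ((nf N').count Q), ?_⟩
        apply Submodule.sub_mem
        · by_cases h : Q ∈ (nf N).toFinset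
          · exact Wp_mono Q (le_max_left _ _) (mem_Vf.mp (ext1 Q h)).1
          · rw [ext0 Q h]; exact Submodule.zero_mem _
        · by_cases h : Q ∈ (nf N').toFinset
          · exact Wp_mono Q (le_max_right _ _) (mem_Vf.mp (ext1' Q h)).1
          · rw [ext0' Q h]; exact Submodule.zero_mem _) P hP (by
        rw [hzero]; exact cop_poly P g)
      exact sub_eq_zero.mp this
    · rw [hSdef, Finset.mem_union, not_or] at hP
      rw [ext0 P hP.1, ext0' P hP.2]
  have hcount : nf N = nf N' := by
    ext P
    by_cases h : P ∈ (nf N).toFinset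
    · by_cases h' : P ∈ (nf N').toFinset
      · have h1 := ext1 P h
        rw [hall P] at h1
        exact Vf_unique h1 (ext1' P h')
      · exact absurd ((hall P).trans (ext0' P h')) (Vf_ne_zero (ext1 P h))
    · by_cases h' : P ∈ (nf N').toFinset
      · exact absurd ((hall P).symm.trans (ext0 P h)) (Vf_ne_zero (ext1' P h'))
      · rw [Multiset.mem_toFinset] at h h'
        rw [Multiset.count_eq_zero_of_notMem h, Multiset.count_eq_zero_of_notMem h']
  have hNN : N = N' := by rw [← nf_prod hN.1, ← nf_prod hN'.1, hcount]
  subst hNN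
  congr 1
  funext P h
  have := hall P
  unfold exte at this
  rwa [dif_pos h, dif_pos h] at this

theorem Phi_inj (r : ℕ) : Set.InjOn (Phi (Fq := Fq)) (Tidx Fq r) := by
  intro σ hσ σ' hσ' heq
  exact Phi_inj_gen r r 0 σ σ' hσ hσ' (by rw [heq]; simp [ι])

open scoped Classical in
theorem Ffam_eq (r : ℕ) : Ffam Fq r = ↑((Tidx Fq r).image Phi) := by
  ext u
  rw [Finset.mem_coe, Finset.mem_image]
  constructor
  · rintro ⟨S, e, a, h1, h2, h3, h4, h5, h6⟩
    set m : Multiset (Polynomial Fq) := ∑ P ∈ S, Multiset.replicate (e P) P with hm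
    have hmem : ∀ P, P ∈ m ↔ P ∈ S := by
      intro P
      rw [hm, Multiset.mem_sum]
      constructor
      · rintro ⟨Q, hQ, hP⟩
        rw [Multiset.eq_of_mem_replicate hP]; exact hQ
      · intro hP
        exact ⟨P, hP, by rw [Multiset.mem_replicate]; exact ⟨by have := h2 P hP; omega, rfl⟩⟩
    have hcount : ∀ P ∈ S, m.count P = e P := by
      intro P hP
      rw [hm, Multiset.count_sum', Finset.sum_eq_single P]
      · simp
      · intro Q _ hQ
        rw [Multiset.count_replicate, if_neg hQ]
      · intro h; exact absurd hP h
    have hirr : ∀ P ∈ m, Irreducible P ∧ P.Monic := by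
      intro P hP
      have := h1 P ((hmem P).mp hP)
      exact ⟨this.2, this.1⟩
    have hnf : nf m.prod = m := nf_of_prod m hirr
    have hmon : m.prod.Monic := by
      simpa using monic_multiset_prod_of_monic m id (fun P hP => (hirr P hP).2)
    refine ⟨⟨m.prod, fun P _ => ∑ i ∈ Finset.Icc 1 (e P), ι (a P i) / ι P ^ (2 * i - 1)⟩, ?_, ?_⟩
    · rw [Tidx, Finset.mem_sigma, mem_monics, Finset.mem_pi]
      refine ⟨⟨hmon, ?_⟩, ?_⟩
      · dsimp only
        rw [natDegree_multiset_prod_of_monic _ (fun P hP => (hirr P hP).2), ← h5,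
          Finset.sum_multiset_map_count]
        have hS : m.toFinset = S := by
          ext P
          rw [Multiset.mem_toFinset, hmem]
        rw [hS]
        apply Finset.sum_congr rfl
        intro P hP
        rw [hcount P hP, smul_eq_mul]
      · intro P hP
        dsimp only at hP ⊢
        rw [hnf, Multiset.mem_toFinset, hmem] at hP
        rw [hnf, hcount P hP, Vf_tuple (h1 P hP).2 (h2 P hP)]
        exact ⟨a P, h3 P hP, h4 P hP, rfl⟩
    · unfold Phi
      dsimp only
      rw [Finset.sum_attach (nf m.prod).toFinset
        (fun P => ∑ i ∈ Finset.Icc 1 (e P), ι (a P i) / ι P ^ (2 * i - 1)), hnf, h6]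
      apply Finset.sum_congr _ (fun _ _ => rfl)
      ext P
      rw [Multiset.mem_toFinset, hmem]
  · rintro ⟨⟨N, x⟩, hσ, rfl⟩
    rw [Tidx, Finset.mem_sigma, mem_monics, Finset.mem_pi] at hσ
    obtain ⟨hN, hx⟩ := hσ
    dsimp only at hN hx
    have hpr : ∀ P ∈ (nf N).toFinset, Irreducible P ∧ P.Monic := by
      intro P hP
      rw [Multiset.mem_toFinset, nf_mem hN.1.ne_zero] at hP
      exact ⟨hP.1, hP.2.1⟩
    have hcp : ∀ P ∈ (nf N).toFinset, 1 ≤ (nf N).count P := by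
      intro P hP
      rw [Multiset.mem_toFinset] at hP
      exact Multiset.one_le_count_iff_mem.mpr hP
    have hex : ∀ P, ∃ a : ℕ → Polynomial Fq, P ∈ (nf N).toFinset →
        ((∀ i, 1 ≤ i → i ≤ (nf N).count P → (a i).degree < P.degree) ∧ a ((nf N).count P) ≠ 0 ∧
        exte x P = ∑ i ∈ Finset.Icc 1 ((nf N).count P), ι (a i) / ι P ^ (2 * i - 1)) := by
      intro P
      by_cases hP : P ∈ (nf N).toFinset
      · obtain ⟨a, ha⟩ := (Vf_tuple (hpr P hP).1 (hcp P hP)).mp (hx P hP)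
        refine ⟨a, fun _ => ?_⟩
        unfold exte
        rw [dif_pos hP]
        exact ha
      · exact ⟨fun _ => 0, fun h => absurd h hP⟩
    choose a ha using hex
    refine ⟨(nf N).toFinset, fun P => (nf N).count P, a, fun P hP => ⟨(hpr P hP).2, (hpr P hP).1⟩,
      hcp, fun P hP => (ha P hP).1, fun P hP => (ha P hP).2.1, ?_, ?_⟩
    · rw [← hN.2]
      conv_rhs => rw [← nf_prod hN.1, natDegree_multiset_prod_of_monic _ (fun P hP =>
        (hpr P (Multiset.mem_toFinset.mpr hP)).2), Finset.sum_multiset_map_count]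
      simp
    · rw [Phi_eq]
      exact Finset.sum_congr rfl (fun P hP => (ha P hP).2.2)

end EvenChar

namespace EvenChar

variable {Fq : Type} [Field Fq] [Fintype Fq]

open scoped Classical in
theorem perN_bound [CharP Fq 2] {f b : Polynomial Fq} (hf : f.Monic) (hb : derivative f = b ^ 2)
    {ξ : Fq} (hξ : ∀ x : Fq, x ^ 2 + x ≠ ξ) {N : Polynomial Fq} (hN : N.Monic) :
    ∃ K : Polynomial Fq, K.Monic ∧ K ∣ b ∧ K ∣ N ∧
      |∑ x ∈ (nf N).toFinset.pi (fun P => Vf P ((nf N).count P)), quadSym (Phi ⟨N, x⟩) f| ≤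
        (Fintype.card Fq : ℤ) ^ K.natDegree := by
  have hpr : ∀ P ∈ (nf N).toFinset, Irreducible P ∧ P.Monic ∧ P ∣ N := by
    intro P hP
    rw [Multiset.mem_toFinset, nf_mem hN.ne_zero] at hP
    exact hP
  by_cases hcop : ∀ P ∈ (nf N).toFinset, IsCoprime f P
  · have hex : ∀ P, ∃ k, P ∈ (nf N).toFinset → k ≤ (nf N).count P ∧ P ^ k ∣ b ∧
        |∑ u ∈ Vf P ((nf N).count P), quadSym u f| ≤ (Fintype.card Fq : ℤ) ^ (k * P.natDegree) := by
      intro P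
      by_cases hP : P ∈ (nf N).toFinset
      · obtain ⟨k, hk⟩ := local_bound hf hb hξ (hpr P hP).1 (hpr P hP).2.1 (hcop P hP)
          ((nf N).count P)
        exact ⟨k, fun _ => hk⟩
      · exact ⟨0, fun h => absurd h hP⟩
    choose k hk using hex
    have hpair : (((nf N).toFinset : Set (Polynomial Fq))).Pairwise
        (Function.onFun IsCoprime fun P => P ^ k P) := by
      intro P hP Q hQ hne
      exact (cop_of_ne (hpr P hP).1 (hpr P hP).2.1 (hpr Q hQ).1 (hpr Q hQ).2.1 hne).pow
    refine ⟨∏ P ∈ (nf N).toFinset, P ^ k P, ?_, ?_, ?_, ?_⟩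
    · exact monic_prod_of_monic _ _ (fun P hP => (hpr P hP).2.1.pow _)
    · exact Finset.prod_dvd_of_coprime hpair (fun P hP => (hk P hP).2.1)
    · conv_rhs => rw [← nf_prod hN, Finset.prod_multiset_count]
      exact Finset.prod_dvd_prod_of_dvd _ _ (fun P hP => pow_dvd_pow _ (hk P hP).1)
    · have h1 : ∀ x ∈ (nf N).toFinset.pi (fun P => Vf P ((nf N).count P)),
          quadSym (Phi ⟨N, x⟩) f = ∏ P ∈ (nf N).toFinset.attach, quadSym (x P.1 P.2) f := by
        intro x hx
        rw [Finset.mem_pi] at hx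
        unfold Phi
        apply quadSym_sum hf
        intro P _
        exact Wp_cop (hpr P.1 P.2).1 (mem_Vf.mp (hx P.1 P.2)).1 (hcop P.1 P.2)
      rw [Finset.sum_congr rfl h1, ← Finset.prod_sum (nf N).toFinset
        (fun P => Vf P ((nf N).count P)) (fun _ u => quadSym u f), Finset.abs_prod,
        natDegree_prod_of_monic _ _ (fun P hP => (hpr P hP).2.1.pow _), ← Finset.prod_pow_eq_pow_sum]
      apply Finset.prod_le_prod
      · intros; exact abs_nonneg _
      · intro P hP
        rw [natDegree_pow]
        exact (hk P hP).2.2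
  · push Not at hcop
    obtain ⟨P, hP, hPf⟩ := hcop
    refine ⟨1, monic_one, one_dvd _, one_dvd _, ?_⟩
    rw [Finset.sum_eq_zero]
    · simp
    · intro x hx
      rw [Finset.mem_pi] at hx
      have ext1 : ∀ P, P ∈ (nf N).toFinset → exte x P ∈ Vf P ((nf N).count P) := by
        intro P h; unfold exte; rw [dif_pos h]; exact hx P h
      rw [Phi_eq]
      unfold quadSym
      rw [if_neg]
      intro hc
      have hPf' : P ∣ f := by
        rcases (hpr P hP).1.isCoprime_or_dvd f with h | h
        · exact absurd h.symm hPf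
        · exact h
      exact Vf_ne_zero (ext1 P hP) (part_zero (nf N).toFinset
        (fun Q hQ => ⟨(hpr Q hQ).1, (hpr Q hQ).2.1⟩) (exte x)
        (fun Q hQ => ⟨_, (mem_Vf.mp (ext1 Q hQ)).1⟩) P hP (hc.of_isCoprime_of_dvd_left hPf'))

open scoped Classical in
/-- Monic divisors. -/
def divs (b : Polynomial Fq) : Finset (Polynomial Fq) :=
  ((nf b).powerset.map Multiset.prod).toFinset

theorem mem_divs {b K : Polynomial Fq} (hb : b ≠ 0) (hK : K.Monic) (h : K ∣ b) : K ∈ divs b := by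
  classical
  unfold divs
  rw [Multiset.mem_toFinset, Multiset.mem_map]
  refine ⟨nf K, ?_, nf_prod hK⟩
  rw [Multiset.mem_powerset]
  unfold nf
  exact (dvd_iff_normalizedFactors_le_normalizedFactors hK.ne_zero hb).mp h

theorem card_divs {b : Polynomial Fq} (hb : b ≠ 0) : (divs b).card ≤ 2 ^ b.natDegree := by
  classical
  unfold divs
  refine (Multiset.toFinset_card_le _).trans ?_
  rw [Multiset.card_map, Multiset.card_powerset]
  apply Nat.pow_le_pow_right (by norm_num)
  have h0 : (0 : Polynomial Fq) ∉ nf b := by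
    intro h
    exact ((nf_mem hb).mp h).1.ne_zero rfl
  have h1 : ((nf b).prod).natDegree = b.natDegree := by
    unfold nf
    exact natDegree_eq_of_degree_eq (degree_eq_degree_of_associated (prod_normalizedFactors hb))
  rw [← h1, natDegree_multiset_prod _ h0]
  have := Multiset.card_nsmul_le_sum (s := (nf b).map natDegree) (a := 1) (by
    intro x hx
    rw [Multiset.mem_map] at hx
    obtain ⟨P, hP, rfl⟩ := hx
    exact ((nf_mem hb).mp hP).1.natDegree_pos)
  simpa using this

open scoped Classical in
theorem card_mult {K : Polynomial Fq} (hK : K.Monic) (r : ℕ) :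
    Fintype.card Fq ^ K.natDegree * ((monics Fq r).filter (fun N => K ∣ N)).card ≤
      Fintype.card Fq ^ r := by
  by_cases h : K.natDegree ≤ r
  · have h1 : (monics Fq r).filter (fun N => K ∣ N) ⊆
        (monics Fq (r - K.natDegree)).image (fun R => K * R) := by
      intro N hN
      rw [Finset.mem_filter, mem_monics] at hN
      obtain ⟨⟨h1, h2⟩, R, rfl⟩ := hN
      rw [Finset.mem_image]
      have hR : R.Monic := hK.of_mul_monic_left h1
      refine ⟨R, ?_, rfl⟩
      rw [mem_monics]
      refine ⟨hR, ?_⟩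
      rw [hK.natDegree_mul hR] at h2
      omega
    have h2 : ((monics Fq r).filter (fun N => K ∣ N)).card ≤
        Fintype.card Fq ^ (r - K.natDegree) := by
      refine (Finset.card_le_card h1).trans (Finset.card_image_le.trans ?_)
      unfold monics
      rw [← Set.ncard_eq_toFinset_card _ (monics_finite _).1]
      exact (monics_finite _).2
    calc _ ≤ Fintype.card Fq ^ K.natDegree * Fintype.card Fq ^ (r - K.natDegree) :=
          Nat.mul_le_mul_left _ h2
      _ = _ := by rw [← pow_add]; congr 1; omega
  · rw [Finset.filter_false_of_mem]
    · simp
    · intro N hN hd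
      rw [mem_monics] at hN
      have := natDegree_le_of_dvd hd hN.1.ne_zero
      omega

open scoped Classical in
theorem F_bound [CharP Fq 2] {f b : Polynomial Fq} (hf : f.Monic) (hb : derivative f = b ^ 2)
    (hb0 : b ≠ 0) {ξ : Fq} (hξ : ∀ x : Fq, x ^ 2 + x ≠ ξ) (r : ℕ) :
    |∑ v ∈ (Tidx Fq r).image Phi, quadSym v f| ≤
      (Fintype.card Fq : ℤ) ^ r * 2 ^ b.natDegree := by
  rw [Finset.sum_image (Phi_inj r), Tidx, Finset.sum_sigma]
  have hex : ∀ N : Polynomial Fq, ∃ K : Polynomial Fq, N.Monic → K.Monic ∧ K ∣ b ∧ K ∣ N ∧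
      |∑ x ∈ (nf N).toFinset.pi (fun P => Vf P ((nf N).count P)), quadSym (Phi ⟨N, x⟩) f| ≤
        (Fintype.card Fq : ℤ) ^ K.natDegree := by
    intro N
    by_cases h : N.Monic
    · obtain ⟨K, hK⟩ := perN_bound hf hb hξ h
      exact ⟨K, fun _ => hK⟩
    · exact ⟨0, fun h' => absurd h' h⟩
  choose K hK using hex
  calc _ ≤ ∑ N ∈ monics Fq r, |∑ x ∈ (nf N).toFinset.pi (fun P => Vf P ((nf N).count P)),
            quadSym (Phi ⟨N, x⟩) f| := Finset.abs_sum_le_sum_abs _ _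
    _ ≤ ∑ N ∈ monics Fq r, ∑ D ∈ (divs b).filter Monic,
          if D ∣ N then (Fintype.card Fq : ℤ) ^ D.natDegree else 0 := by
        apply Finset.sum_le_sum
        intro N hN
        obtain ⟨h1, h2, h3, h4⟩ := hK N (mem_monics.mp hN).1
        refine h4.trans ?_
        have := Finset.single_le_sum (s := (divs b).filter Monic) (f := fun D : Polynomial Fq =>
          if D ∣ N then (Fintype.card Fq : ℤ) ^ D.natDegree else 0)
          (fun D _ => by split_ifs <;> positivity)
          (Finset.mem_filter.mpr ⟨mem_divs hb0 h1 h2, h1⟩)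
        rwa [if_pos h3] at this
    _ = ∑ D ∈ (divs b).filter Monic, (Fintype.card Fq : ℤ) ^ D.natDegree *
          ((monics Fq r).filter (fun N => D ∣ N)).card := by
        rw [Finset.sum_comm]
        apply Finset.sum_congr rfl
        intro D _
        rw [← Finset.sum_filter, Finset.sum_const, nsmul_eq_mul, mul_comm]
    _ ≤ ∑ D ∈ (divs b).filter Monic, (Fintype.card Fq : ℤ) ^ r := by
        apply Finset.sum_le_sum
        intro D hD
        exact_mod_cast card_mult (Finset.mem_filter.mp hD).2 r
    _ ≤ _ := by
        rw [Finset.sum_const, nsmul_eq_mul, mul_comm]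
        apply mul_le_mul_of_nonneg_left _ (by positivity)
        exact_mod_cast (Finset.card_filter_le _ _).trans (card_divs hb0)

end EvenChar

namespace EvenChar

variable {Fq : Type} [Field Fq] [Fintype Fq]

/-- Odd polynomials with given coefficients. -/
def op (s : ℕ) (c : ℕ → Fq) : Polynomial Fq := ∑ i ∈ Finset.Icc 1 s, C (c i) * X ^ (2 * i - 1)

/-- The space of odd polynomials of degree at most `2 * s - 1`. -/
def Us (Fq : Type) [Field Fq] [Fintype Fq] (s : ℕ) : Submodule Fq (RatFunc Fq) :=
  Submodule.span Fq ((fun i : ℕ => ι (X ^ (2 * i - 1) : Polynomial Fq)) '' (Finset.Icc 1 s))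

theorem mem_Us {s : ℕ} {u : RatFunc Fq} : u ∈ Us Fq s ↔ ∃ c : ℕ → Fq, u = ι (op s c) := by
  unfold Us
  rw [Submodule.mem_span_image_finset_iff_exists_fun']
  have : ∀ c : ℕ → Fq, ∑ i ∈ Finset.Icc 1 s, c i • ι (X ^ (2 * i - 1) : Polynomial Fq) =
      ι (op s c) := by
    intro c
    unfold op ι
    rw [map_sum]
    apply Finset.sum_congr rfl
    intro i _
    rw [Algebra.smul_def, map_mul, IsScalarTower.algebraMap_apply Fq (Polynomial Fq) (RatFunc Fq),
      algebraMap_eq]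
  constructor
  · rintro ⟨c, rfl⟩; exact ⟨c, this c⟩
  · rintro ⟨c, rfl⟩; exact ⟨c, this c⟩

theorem coeff_op (s : ℕ) (c : ℕ → Fq) (i : ℕ) (hi : 1 ≤ i) :
    (op s c).coeff (2 * i - 1) = if i ≤ s then c i else 0 := by
  unfold op
  rw [finset_sum_coeff]
  simp only [coeff_C_mul, coeff_X_pow]
  split_ifs with h
  · rw [Finset.sum_eq_single i]
    · simp
    · intro j hj hne
      rw [Finset.mem_Icc] at hj
      rw [if_neg (by omega), mul_zero]
    · intro h'
      rw [Finset.mem_Icc] at h'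
      omega
  · apply Finset.sum_eq_zero
    intro j hj
    rw [Finset.mem_Icc] at hj
    rw [if_neg (by omega), mul_zero]

theorem coeff_op_zero (s : ℕ) (c : ℕ → Fq) : (op s c).coeff 0 = 0 := by
  unfold op
  rw [finset_sum_coeff]
  apply Finset.sum_eq_zero
  intro j hj
  rw [Finset.mem_Icc] at hj
  rw [coeff_C_mul, coeff_X_pow, if_neg (by omega), mul_zero]

theorem ι_inj {p p' : Polynomial Fq} (h : ι p = ι p') : p = p' :=
  IsFractionRing.injective (Polynomial Fq) (RatFunc Fq) h

theorem Us_fin (s : ℕ) : (Us Fq s : Set (RatFunc Fq)).Finite ∧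
    (Us Fq s : Set (RatFunc Fq)).ncard ≤ Fintype.card Fq ^ s := by
  classical
  apply ncard_le_of_finrank
  · unfold Us
    rw [← Finset.coe_image]
    exact Module.Finite.span_finset _ _
  · unfold Us
    rw [← Finset.coe_image]
    refine (finrank_span_finset_le_card _).trans (Finset.card_image_le.trans ?_)
    simp

theorem Us_mono {s s' : ℕ} (h : s ≤ s') : Us Fq s ≤ Us Fq s' := by
  unfold Us
  apply Submodule.span_mono
  apply Set.image_mono
  exact_mod_cast Finset.Icc_subset_Icc_right h

theorem Us_cop (f : Polynomial Fq) {s : ℕ} {u : RatFunc Fq} (hu : u ∈ Us Fq s) :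
    IsCoprime f u.denom := by
  obtain ⟨c, rfl⟩ := mem_Us.mp hu
  exact cop_poly _ _

/-- Odd polynomials of degree exactly `2 * s - 1`. -/
def Hs (Fq : Type) [Field Fq] [Fintype Fq] (s : ℕ) : Finset (RatFunc Fq) :=
  ((Us_fin (Fq := Fq) s).1.subset
    (Set.diff_subset (t := (Us Fq (s - 1) : Set (RatFunc Fq))))).toFinset

theorem mem_Hs {s : ℕ} {u : RatFunc Fq} : u ∈ Hs Fq s ↔ u ∈ Us Fq s ∧ u ∉ Us Fq (s - 1) := by
  simp [Hs]

theorem mem_Hs' {s : ℕ} (hs : 1 ≤ s) {u : RatFunc Fq} :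
    u ∈ Hs Fq s ↔ ∃ c : ℕ → Fq, c s ≠ 0 ∧ u = ι (op s c) := by
  rw [mem_Hs, mem_Us]
  constructor
  · rintro ⟨⟨c, rfl⟩, h2⟩
    refine ⟨c, ?_, rfl⟩
    intro h0
    apply h2
    rw [mem_Us]
    refine ⟨c, ?_⟩
    obtain ⟨t, rfl⟩ : ∃ t, s = t + 1 := ⟨s - 1, by omega⟩
    rw [Nat.add_sub_cancel]
    unfold op
    rw [Finset.sum_Icc_succ_top (by omega), h0]
    simp
  · rintro ⟨c, h0, rfl⟩
    refine ⟨⟨c, rfl⟩, ?_⟩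
    rw [mem_Us]
    rintro ⟨c', h⟩
    have h1 := congrArg (fun p => p.coeff (2 * s - 1)) (ι_inj h)
    rw [coeff_op _ _ _ hs, coeff_op _ _ _ hs, if_pos le_rfl, if_neg (by omega)] at h1
    exact h0 h1

theorem Hs_poly {s : ℕ} (hs : 1 ≤ s) {u : RatFunc Fq} (hu : u ∈ Hs Fq s) :
    ∃ p : Polynomial Fq, u = ι p ∧ p.coeff 0 = 0 := by
  obtain ⟨c, -, rfl⟩ := (mem_Hs' hs).mp hu
  exact ⟨_, rfl, coeff_op_zero _ _⟩

theorem Lam_const {f : Polynomial Fq} (hf : f.Monic) (a : Fq) :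
    Lam f (ι (C a)) = algebraMap Fq (Lc Fq) (f.natDegree * a) := by
  rw [Lam_poly]
  simp only [aeval_C, Multiset.map_const', Multiset.sum_replicate, nsmul_eq_mul]
  have : (f.aroots (Lc Fq)).card = f.natDegree := by
    rw [aroots_def, splits_iff_card_roots.mp (IsAlgClosed.splits (f.map (algebraMap Fq (Lc Fq)))),
      natDegree_map]
  rw [this]
  simp

theorem quadSym_xi [CharP Fq 2] {f : Polynomial Fq} (hf : f.Monic) {ξ : Fq}
    (hξ : ∀ x : Fq, x ^ 2 + x ≠ ξ) (hd : Odd f.natDegree) : quadSym (ι (C ξ)) f = -1 := by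
  obtain ⟨t, h1, h2⟩ := quadSym_eq hf (cop_poly f (C ξ))
  rw [h2]
  rw [Lam_const hf] at h1
  have h3 := (algebraMap Fq (Lc Fq)).injective h1
  obtain ⟨k, hk⟩ := hd
  have h4 : (f.natDegree : Fq) = 1 := by
    rw [hk]; push_cast; rw [CharTwo.two_eq_zero]; ring
  rw [h4, one_mul] at h3
  rw [h3]
  unfold psi
  rw [if_neg]
  rintro ⟨x, hx⟩
  exact hξ x hx

theorem Lam_pow_zero [CharP Fq 2] {f : Polynomial Fq} (hf : f.Monic) {ξ : Fq}
    (hξ : ∀ x : Fq, x ^ 2 + x ≠ ξ) (hd : Even f.natDegree) (s : ℕ)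
    (h1 : ∀ u ∈ Us Fq s, quadSym u f = 1) : ∀ j < 2 * s + 1, Lam f (ι (X ^ j)) = 0 := by
  intro j
  induction j using Nat.strong_induction_on with
  | _ j ih =>
    intro hj
    rcases Nat.even_or_odd j with h | h
    · obtain ⟨k, rfl⟩ := h
      by_cases hk : k = 0
      · subst hk
        have : (X ^ (0 + 0) : Polynomial Fq) = C 1 := by simp
        rw [this, Lam_const hf]
        obtain ⟨m, hm⟩ := hd
        rw [hm]; push_cast
        rw [CharTwo.add_self_eq_zero]; simp
      · have : ι (X ^ (k + k) : Polynomial Fq) = ι (X ^ k) * ι (X ^ k) := by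
          unfold ι; rw [pow_add, map_mul]
        rw [this, Lam_sq (cop_poly _ _), ih k (by omega) (by omega)]
        simp
    · obtain ⟨k, rfl⟩ := h
      apply Lam_of_triv hf hξ (Us Fq s) (fun u hu => Us_cop f hu) h1
      unfold Us
      apply Submodule.subset_span
      refine ⟨k + 1, ?_, ?_⟩
      · simp; omega
      · rfl

theorem deg_bound [CharP Fq 2] {f b : Polynomial Fq} (hf : f.Monic) (hb : derivative f = b ^ 2)
    (hb0 : b ≠ 0) {ξ : Fq} (hξ : ∀ x : Fq, x ^ 2 + x ≠ ξ) (hd : Even f.natDegree) (s : ℕ)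
    (h1 : ∀ u ∈ Us Fq s, quadSym u f = 1) : 2 * b.natDegree + 2 * s + 2 ≤ f.natDegree := by
  by_contra h
  have h2 := coeff_derivative_zero hf (Lam_pow_zero hf hξ hd s h1) (2 * b.natDegree) (by omega)
  rw [hb, ← natDegree_pow] at h2
  have h3 : (b ^ 2).leadingCoeff = 0 := h2
  rw [leadingCoeff_eq_zero] at h3
  exact hb0 (pow_eq_zero_iff two_ne_zero |>.mp h3)

theorem arith_a {A B q : ℤ} {s k m : ℕ} (hA0 : 0 ≤ A) (hB0 : 0 ≤ B) (hA : A ≤ 2) (hB : B ≤ q ^ s)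
    (hq : 2 ≤ q) (h : k + s + 1 ≤ m) : A * B * 2 ^ k * 2 ^ s ≤ q ^ s * 2 ^ m := by
  calc _ ≤ (2 * q ^ s) * 2 ^ k * 2 ^ s := by gcongr
    _ = q ^ s * 2 ^ (k + s + 1) := by ring
    _ ≤ _ := by
      apply mul_le_mul_of_nonneg_left _ (by positivity)
      exact pow_le_pow_right₀ (by norm_num) h

theorem arith_b {A B q : ℤ} {s k m : ℕ} (hA0 : 0 ≤ A) (hB0 : 0 ≤ B) (hA : A ≤ 2)
    (hB : B ≤ q ^ (s - 1)) (hq : 2 ≤ q) (hs : 1 ≤ s) (h : k + s ≤ m) :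
    A * B * 2 ^ k * 2 ^ s ≤ q ^ s * 2 ^ m := by
  have h1 : q * q ^ (s - 1) = q ^ s := by rw [← pow_succ', Nat.sub_add_cancel hs]
  have h2 : A * B ≤ q ^ s := by
    rw [← h1]
    exact mul_le_mul (hA.trans hq) hB hB0 (by omega)
  calc _ ≤ q ^ s * 2 ^ k * 2 ^ s := by gcongr
    _ = q ^ s * 2 ^ (k + s) := by ring
    _ ≤ _ := by
      apply mul_le_mul_of_nonneg_left _ (by positivity)
      exact pow_le_pow_right₀ (by norm_num) h

open scoped Classical in
theorem G_bound [CharP Fq 2] {f b : Polynomial Fq} (hf : f.Monic) (hb : derivative f = b ^ 2)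
    (hb0 : b ≠ 0) {ξ : Fq} (hξ : ∀ x : Fq, x ^ 2 + x ≠ ξ) (s : ℕ) (hs : 1 ≤ s) :
    (|(∑ α ∈ ({0, ξ} : Finset Fq), quadSym (ι (C α)) f) * ∑ w ∈ Hs Fq s, quadSym w f| = 0) ∨
    (Even f.natDegree ∧
     |(∑ α ∈ ({0, ξ} : Finset Fq), quadSym (ι (C α)) f) * ∑ w ∈ Hs Fq s, quadSym w f| *
      2 ^ b.natDegree * 2 ^ s ≤ (Fintype.card Fq : ℤ) ^ s * 2 ^ (f.natDegree / 2)) := by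
  have hξ0 : (0 : Fq) ≠ ξ := by
    have := hξ 0
    simpa using this
  have h0 : quadSym (ι (C (0 : Fq))) f = 1 := by
    have := quadSym_zero hf
    simpa [ι] using this
  rw [Finset.sum_pair hξ0, h0]
  rcases Nat.even_or_odd f.natDegree with hd | hd
  · have hA : |1 + quadSym (ι (C ξ)) f| ≤ 2 := by
      rcases quadSym_abs hf (ι (C ξ)) with h | h | h <;> rw [h] <;> norm_num
    have hq : (2 : ℤ) ≤ Fintype.card Fq := by
      exact_mod_cast Fintype.one_lt_card
    obtain ⟨m, hm⟩ := hd
    have hm2 : f.natDegree / 2 = m := by omega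
    rw [hm2]
    rcases sum_diff hf (Us Fq s) (Us Fq (s - 1)) (Us_mono (by omega)) (fun u hu => Us_cop f hu)
      (Us_fin s).1 (Hs Fq s) (fun u => mem_Hs) with ⟨h1, h2⟩ | ⟨h1, h2⟩ | h
    · right
      refine ⟨⟨m, hm⟩, ?_⟩
      have h3 := deg_bound hf hb hb0 hξ ⟨m, hm⟩ s h1
      have h4 : |∑ w ∈ Hs Fq s, quadSym w f| ≤ (Fintype.card Fq : ℤ) ^ s :=
        h2.trans (by exact_mod_cast (Us_fin s).2)
      rw [abs_mul]
      exact arith_a (abs_nonneg _) (abs_nonneg _) hA h4 hq (by omega)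
    · right
      refine ⟨⟨m, hm⟩, ?_⟩
      have h3 := deg_bound hf hb hb0 hξ ⟨m, hm⟩ (s - 1) h1
      have h4 : |∑ w ∈ Hs Fq s, quadSym w f| ≤ (Fintype.card Fq : ℤ) ^ (s - 1) :=
        h2.trans (by exact_mod_cast (Us_fin (s - 1)).2)
      rw [abs_mul]
      exact arith_b (abs_nonneg _) (abs_nonneg _) hA h4 hq hs (by omega)
    · left
      rw [h]; simp
  · left
    rw [quadSym_xi hf hξ hd]; simp

end EvenChar

namespace EvenChar

variable {Fq : Type} [Field Fq] [Fintype Fq]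

open scoped Classical in
/-- The map parametrizing `I_{(r,s)}`. -/
def Psi (x : (Σ N : Polynomial Fq, (P : Polynomial Fq) → P ∈ (nf N).toFinset → RatFunc Fq) ×
    (Fq × RatFunc Fq)) : RatFunc Fq := Phi x.1 + (ι (C x.2.1) + x.2.2)

open scoped Classical in
/-- The index set of `I_{(r,s)}`. -/
def Jidx (ξ : Fq) (r s : ℕ) :
    Finset ((Σ N : Polynomial Fq, (P : Polynomial Fq) → P ∈ (nf N).toFinset → RatFunc Fq) ×
    (Fq × RatFunc Fq)) := Tidx Fq r ×ˢ (({0, ξ} : Finset Fq) ×ˢ Hs Fq s)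

open scoped Classical in
/-- `I_{(r,s)}` as a finite set. -/
def Ifin (ξ : Fq) (r s : ℕ) : Finset (RatFunc Fq) := (Jidx ξ r s).image Psi

theorem Irs_eq (ξ : Fq) (r s : ℕ) (hs : 1 ≤ s) : Irs ξ r s = ↑(Ifin ξ r s) := by
  classical
  ext u
  rw [Finset.mem_coe, Ifin, Finset.mem_image]
  constructor
  · rintro ⟨v, hv, G, ⟨α, c, hα, hc, rfl⟩, rfl⟩
    rw [Ffam_eq, Finset.mem_coe, Finset.mem_image] at hv
    obtain ⟨σ, hσ, rfl⟩ := hv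
    refine ⟨(σ, α, ι (op s c)), ?_, ?_⟩
    · rw [Jidx, Finset.mem_product, Finset.mem_product]
      refine ⟨hσ, ?_, (mem_Hs' hs).mpr ⟨c, hc, rfl⟩⟩
      simpa using hα
    · unfold Psi op ι
      rw [map_add]
  · rintro ⟨⟨σ, α, w⟩, hx, rfl⟩
    rw [Jidx, Finset.mem_product, Finset.mem_product] at hx
    obtain ⟨h1, h2, h3⟩ := hx
    dsimp only at h1 h2 h3
    obtain ⟨c, hc, rfl⟩ := (mem_Hs' hs).mp h3
    refine ⟨Phi σ, ?_, C α + op s c, ⟨α, c, by simpa using h2, hc, rfl⟩, ?_⟩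
    · rw [Ffam_eq, Finset.mem_coe, Finset.mem_image]
      exact ⟨σ, h1, rfl⟩
    · unfold Psi ι
      rw [map_add]

open scoped Classical in
theorem Psi_inj (ξ : Fq) {r s r' s' : ℕ} (hs : 1 ≤ s) (hs' : 1 ≤ s')
    {x y : (Σ N : Polynomial Fq, (P : Polynomial Fq) → P ∈ (nf N).toFinset → RatFunc Fq) ×
    (Fq × RatFunc Fq)} (hx : x ∈ Jidx ξ r s) (hy : y ∈ Jidx ξ r' s') (h : Psi x = Psi y) :
    x = y ∧ s = s' := by
  obtain ⟨σ, α, w⟩ := x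
  obtain ⟨σ', α', w'⟩ := y
  rw [Jidx, Finset.mem_product, Finset.mem_product] at hx hy
  obtain ⟨h1, -, h3⟩ := hx
  obtain ⟨h1', -, h3'⟩ := hy
  dsimp only at h1 h3 h1' h3'
  obtain ⟨c, hc, rfl⟩ := (mem_Hs' hs).mp h3
  obtain ⟨c', hc', rfl⟩ := (mem_Hs' hs').mp h3'
  unfold Psi at h
  dsimp only at h
  have hσ : σ = σ' := by
    apply Phi_inj_gen r r' (C α' + op s' c' - (C α + op s c)) σ σ' h1 h1'
    unfold ι at h ⊢
    rw [map_sub, map_add, map_add, eq_sub_of_add_eq h]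
    ring
  subst hσ
  have h4 := add_left_cancel h
  unfold ι at h4
  rw [← map_add, ← map_add] at h4
  have h5 := ι_inj h4
  have hα : α = α' := by
    have := congrArg (fun p => p.coeff 0) h5
    simpa [coeff_op_zero] using this
  subst hα
  have h6 := add_left_cancel h5
  refine ⟨by rw [h6], ?_⟩
  rcases lt_trichotomy s s' with hlt | heq | hlt
  · have := congrArg (fun p => p.coeff (2 * s' - 1)) h6
    rw [coeff_op _ _ _ hs', coeff_op _ _ _ hs', if_neg (by omega), if_pos le_rfl] at this
    exact absurd this.symm hc'
  · exact heq
  · have := congrArg (fun p => p.coeff (2 * s - 1)) h6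
    rw [coeff_op _ _ _ hs, coeff_op _ _ _ hs, if_neg (not_le.mpr hlt), if_pos le_rfl] at this
    exact absurd this hc

theorem Irs_sum [CharP Fq 2] {f : Polynomial Fq} (hf : f.Monic) (ξ : Fq) (r s : ℕ) (hs : 1 ≤ s) :
    open scoped Classical in
    ∑ u ∈ Ifin ξ r s, quadSym u f = (∑ v ∈ (Tidx Fq r).image Phi, quadSym v f) *
      ((∑ α ∈ ({0, ξ} : Finset Fq), quadSym (ι (C α)) f) * ∑ w ∈ Hs Fq s, quadSym w f) := by
  classical
  unfold Ifin
  rw [Finset.sum_image (fun x hx y hy h => (Psi_inj ξ hs hs hx hy h).1),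
    Finset.sum_image (Phi_inj r), Jidx, Finset.sum_mul_sum, ← Finset.sum_product',
    Finset.sum_mul_sum, ← Finset.sum_product']
  apply Finset.sum_congr rfl
  rintro ⟨σ, α, w⟩ hx
  rw [Finset.mem_product, Finset.mem_product] at hx
  obtain ⟨p, hp, -⟩ := Hs_poly hs hx.2.2
  dsimp only at hp ⊢
  unfold Psi
  dsimp only
  subst hp
  rw [← add_assoc, quadSym_add_poly hf, quadSym_add_poly hf, mul_assoc]

theorem Irs_bound [CharP Fq 2] {f : Polynomial Fq} (hf : f.Monic) {ξ : Fq}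
    (hξ : ∀ x : Fq, x ^ 2 + x ≠ ξ) (r s : ℕ) (hs : 1 ≤ s)
    (hsq : ¬ ∃ w : Polynomial Fq, f = w ^ 2) :
    |∑ u ∈ Ifin ξ r s, (quadSym u f : ℝ)| ≤
        (2 : ℝ) ^ ((f.natDegree : ℝ) / 2 - (s : ℝ)) * (Fintype.card Fq : ℝ) ^ (r + s) := by
  classical
  obtain ⟨b, hb⟩ := derivative_is_sq f
  have hb0 : b ≠ 0 := by
    rintro rfl
    exact hsq (sq_of_derivative_zero (by simpa using hb))
  have hF := F_bound hf hb hb0 hξ r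
  have hsum := Irs_sum hf ξ r s hs
  have hG := G_bound hf hb hb0 hξ s hs
  set Fs := ∑ v ∈ (Tidx Fq r).image Phi, quadSym v f
  set Gs := (∑ α ∈ ({0, ξ} : Finset Fq), quadSym (ι (C α)) f) * ∑ w ∈ Hs Fq s, quadSym w f
  have hcast : ∑ u ∈ Ifin ξ r s, (quadSym u f : ℝ) = ((Fs * Gs : ℤ) : ℝ) := by
    rw [← hsum]; push_cast; rfl
  rw [hcast]
  rcases hG with h0 | ⟨hd, hG⟩
  · rw [abs_eq_zero] at h0
    rw [h0, mul_zero, Int.cast_zero, abs_zero]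
    positivity
  · obtain ⟨m, hm⟩ := hd
    have hm2 : f.natDegree / 2 = m := by omega
    rw [hm2] at hG
    have key : |Fs * Gs| * 2 ^ s ≤ (Fintype.card Fq : ℤ) ^ (r + s) * 2 ^ m := by
      rw [abs_mul]
      calc |Fs| * |Gs| * 2 ^ s ≤ ((Fintype.card Fq : ℤ) ^ r * 2 ^ b.natDegree) * |Gs| * 2 ^ s := by
            gcongr
        _ = (Fintype.card Fq : ℤ) ^ r * (|Gs| * 2 ^ b.natDegree * 2 ^ s) := by ring
        _ ≤ (Fintype.card Fq : ℤ) ^ r * ((Fintype.card Fq : ℤ) ^ s * 2 ^ m) := by gcongr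
        _ = _ := by ring
    have hexp : (f.natDegree : ℝ) / 2 - (s : ℝ) = (m : ℝ) - (s : ℝ) := by
      rw [hm]; push_cast; ring
    rw [hexp, Real.rpow_sub (by norm_num), Real.rpow_natCast, Real.rpow_natCast, div_mul_eq_mul_div,
      le_div_iff₀ (by positivity), mul_comm ((2 : ℝ) ^ m)]
    exact_mod_cast key

theorem Ifam_eq (ξ : Fq) (n : ℕ) :
    open scoped Classical in
    Ifam ξ n = ↑((Finset.Icc 1 n).biUnion (fun s => Ifin ξ (n - s) s)) := by
  classical
  ext u
  simp only [Ifam, Set.mem_iUnion, Finset.coe_biUnion, exists_prop]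
  constructor
  · rintro ⟨r, s, hs, hrs, hu⟩
    refine ⟨s, ?_, ?_⟩
    · simp; omega
    · rw [Irs_eq _ _ _ hs] at hu
      have : n - s = r := by omega
      rwa [this]
  · rintro ⟨s, hs, hu⟩
    have hs' : 1 ≤ s ∧ s ≤ n := by simpa using hs
    refine ⟨n - s, s, hs'.1, by omega, ?_⟩
    rwa [Irs_eq _ _ _ hs'.1]

theorem half_sum (n : ℕ) : ∑ s ∈ Finset.Icc 1 n, (1 / 2 : ℝ) ^ s ≤ 1 := by
  have : ∑ s ∈ Finset.Icc 1 n, (1 / 2 : ℝ) ^ s = 1 - (1 / 2) ^ n := by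
    induction n with
    | zero => simp
    | succ n ih => rw [Finset.sum_Icc_succ_top (by omega), ih, pow_succ]; ring
  rw [this]
  have : (0 : ℝ) ≤ (1 / 2) ^ n := by positivity
  linarith

theorem Ifam_bound [CharP Fq 2] {f : Polynomial Fq} (hf : f.Monic) {ξ : Fq}
    (hξ : ∀ x : Fq, x ^ 2 + x ≠ ξ) (n : ℕ) (hsq : ¬ ∃ w : Polynomial Fq, f = w ^ 2) :
    |∑' u : (Ifam ξ n : Set (RatFunc Fq)), (quadSym u.1 f : ℝ)| ≤
        (2 : ℝ) ^ ((f.natDegree : ℝ) / 2) * (Fintype.card Fq : ℝ) ^ n := by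
  classical
  rw [Ifam_eq, Finset.tsum_subtype' _ (fun u => (quadSym u f : ℝ)), Finset.sum_biUnion]
  · refine (Finset.abs_sum_le_sum_abs _ _).trans ?_
    calc _ ≤ ∑ s ∈ Finset.Icc 1 n, ((2 : ℝ) ^ ((f.natDegree : ℝ) / 2) *
            (Fintype.card Fq : ℝ) ^ n) * (1 / 2) ^ s := by
          apply Finset.sum_le_sum
          intro s hs
          rw [Finset.mem_Icc] at hs
          refine (Irs_bound hf hξ (n - s) s hs.1 hsq).trans (le_of_eq ?_)
          rw [Nat.sub_add_cancel hs.2, Real.rpow_sub (by norm_num), Real.rpow_natCast, div_pow,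
            one_pow]
          ring
      _ ≤ _ := by
          rw [← Finset.mul_sum]
          exact mul_le_of_le_one_right (by positivity) (half_sum n)
  · intro s hs s' hs' hne
    rw [Finset.mem_coe, Finset.mem_Icc] at hs hs'
    rw [Function.onFun, Finset.disjoint_left]
    intro u hu hu'
    unfold Ifin at hu hu'
    rw [Finset.mem_image] at hu hu'
    obtain ⟨x, hx, h1⟩ := hu
    obtain ⟨y, hy, h2⟩ := hu'
    exact hne (Psi_inj ξ hs.1 hs'.1 hx hy (h1.trans h2.symm)).2

theorem statement19 {Fq : Type} [Field Fq] [Fintype Fq] (hchar : ringChar Fq = 2)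
    (ξ : Fq) (hξ : ∀ x : Fq, x ^ 2 + x ≠ ξ) :
    (∀ r s : ℕ, 1 ≤ s → ∀ f : Polynomial Fq, f.Monic → f.natDegree ≤ r + s - 1 →
      (¬ ∃ w : Polynomial Fq, f = w ^ 2) →
      (∑' u : (Irs ξ r s : Set (RatFunc Fq)), (quadSym u.1 f : ℝ)) ≤
        (2 : ℝ) ^ ((f.natDegree : ℝ) / 2 - (s : ℝ)) * (Fintype.card Fq : ℝ) ^ (r + s)) ∧
    ∃ C : ℝ, 0 < C ∧ ∀ g : ℕ, 1 ≤ g → ∀ f : Polynomial Fq, f.Monic → f.natDegree ≤ g →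
      (¬ ∃ w : Polynomial Fq, f = w ^ 2) →
      |∑' u : (Ifam ξ (g + 1) : Set (RatFunc Fq)), (quadSym u.1 f : ℝ)| ≤
        C * g * (2 : ℝ) ^ ((f.natDegree : ℝ) / 2) * (Fintype.card Fq : ℝ) ^ g := by
  haveI : CharP Fq 2 := ringChar.of_eq hchar
  constructor
  · intro r s hs f hf _ hsq
    rw [Irs_eq ξ r s hs, Finset.tsum_subtype' _ (fun u => (quadSym u f : ℝ))]
    exact (le_abs_self _).trans (Irs_bound hf hξ r s hs hsq)
  · refine ⟨Fintype.card Fq, by exact_mod_cast Fintype.card_pos, ?_⟩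
    intro g hg f hf _ hsq
    refine (Ifam_bound hf hξ (g + 1) hsq).trans ?_
    have hg' : (1 : ℝ) ≤ g := by exact_mod_cast hg
    have h0 : (0 : ℝ) ≤ (2 : ℝ) ^ ((f.natDegree : ℝ) / 2) * (Fintype.card Fq : ℝ) ^ (g + 1) := by
      positivity
    calc _ ≤ (2 : ℝ) ^ ((f.natDegree : ℝ) / 2) * (Fintype.card Fq : ℝ) ^ (g + 1) * g :=
          le_mul_of_one_le_right h0 hg'
      _ = _ := by rw [pow_succ]; ring

end EvenChar
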